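/- arXiv:2601.05471 — 2 statements merged into one kernel-verified Lean document; each statement's English description precedes it below -/
import Mathlib

section
/- Let k and n be positive integers with n ≥ k. Then for every β ∈ ℚ (equivalently, as an identity of polynomials in β), the specialized stable Grothendieck polynomials of adjacent staircase shapes satisfy the recurrence (2k)! · G_{δ_{k+1}}(1,…,1 | β) · F^{(n)}_{δ_k}(−β) = 2^k · k! · (∏_{j=0}^{k−1} (n − k + 1 + 2j)) · G_{δ_k}(1,…,1 | β) · F^{(n)}_{δ_{k+1}}(−β); here the scalar ratio 2^k k! (∏_{j=0}^{k−1} (n−k+1+2j)) / (2k)! equals (2^{2k}(k!)²/(2k)!) · P_k^{(α,β′)}(−1) with Jacobi parameters α = (n−k−1)/2 and β′ = (−n−k−1)/2. -/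
/-- `(i,j)` (0-indexed) is a box of the Young diagram of the staircase `δ_k`,
i.e. the 1-indexed box `(i+1, j+1)` satisfies `(i+1) + (j+1) ≤ k`. -/
def StairBox (k : ℕ) (p : Fin k × Fin k) : Prop := p.1.val + p.2.val + 2 ≤ k

/-- `T` is a set-valued semistandard tableau of staircase shape `δ_k` with entries in
`{1,…,n}` (encoded as `Fin n`): each box carries a nonempty set, non-boxes carry `∅`,
rows are weakly increasing (`max ≤ min`), columns strictly increasing (`max < min`). -/
def IsSVTStair (k n : ℕ) (T : Fin k × Fin k → Finset (Fin n)) : Prop :=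
  (∀ p, StairBox k p → (T p).Nonempty) ∧
  (∀ p, ¬ StairBox k p → T p = ∅) ∧
  (∀ p q : Fin k × Fin k, q.1 = p.1 → (q.2 : ℕ) = (p.2 : ℕ) + 1 →
    ∀ a ∈ T p, ∀ b ∈ T q, a ≤ b) ∧
  (∀ p q : Fin k × Fin k, (q.1 : ℕ) = (p.1 : ℕ) + 1 → q.2 = p.2 →
    ∀ a ∈ T p, ∀ b ∈ T q, a < b)

/-- The specialization `G_{δ_k}(1,…,1 | β) = Σ_{T ∈ SVT(δ_k, n)} β^{|T| - |δ_k|}` of the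
stable Grothendieck polynomial, where `|δ_k| = k(k-1)/2`. -/
noncomputable def GspecStair (k n : ℕ) (b : ℚ) : ℚ :=
  ∑ᶠ T : {T : Fin k × Fin k → Finset (Fin n) // IsSVTStair k n T},
    b ^ ((∑ p : Fin k × Fin k, (T.1 p).card) - k * (k - 1) / 2)

/-- The terminating Holman hypergeometric value `F^{(n)}_λ(z)`. -/
noncomputable def holmanF (n : ℕ) (lam : ℕ → ℕ) (z : ℚ) : ℚ :=
  ∑ κ : (i : Fin n) → Fin (i.val + 1),
    (∏ p ∈ Finset.univ.filter (fun p : Fin n × Fin n => p.1 < p.2),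
        (((lam (p.1.val + 1) : ℚ) - (lam (p.2.val + 1) : ℚ) + (p.2.val : ℚ) - (p.1.val : ℚ)
            + ((κ p.1).val : ℚ) - ((κ p.2).val : ℚ)) /
          ((lam (p.1.val + 1) : ℚ) - (lam (p.2.val + 1) : ℚ) + (p.2.val : ℚ) - (p.1.val : ℚ)))) *
      (∏ i : Fin n, (Nat.choose i.val (κ i).val : ℚ)) *
      (-z) ^ (∑ i : Fin n, (κ i).val)

/-- Generalized binomial coefficient `binom(x, m) = x(x-1)⋯(x-m+1)/m!`. -/
def genBinom (x : ℚ) (m : ℕ) : ℚ := (∏ i ∈ Finset.range m, (x - i)) / (Nat.factorial m)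

/-- The Jacobi polynomial. -/
def jacobiP (k : ℕ) (a b z : ℚ) : ℚ :=
  ∑ r ∈ Finset.range (k + 1),
    genBinom ((k : ℚ) + a) (k - r) * genBinom ((k : ℚ) + b) r *
      ((z - 1) / 2) ^ r * ((z + 1) / 2) ^ (k - r)

section Helpers

open Finset

/-- Set-valued tableaux of shape `lam` drawn in a `K × K` grid, with entries in `ℕ`. -/
structure IsSVT {K : ℕ} (lam : ℕ → ℕ) (T : Fin K × Fin K → Finset ℕ) : Prop where
  nonempty : ∀ p : Fin K × Fin K, p.2.val < lam p.1.val → (T p).Nonempty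
  empty : ∀ p : Fin K × Fin K, ¬ p.2.val < lam p.1.val → T p = ∅
  row : ∀ p q : Fin K × Fin K, q.1 = p.1 → (q.2 : ℕ) = (p.2 : ℕ) + 1 →
    ∀ a ∈ T p, ∀ b ∈ T q, a ≤ b
  col : ∀ p q : Fin K × Fin K, (q.1 : ℕ) = (p.1 : ℕ) + 1 → q.2 = p.2 →
    ∀ a ∈ T p, ∀ b ∈ T q, a < b

open Classical in
/-- The set-valued tableaux of shape `lam` with entries in `{0, …, n - 1}`. -/
noncomputable def svtFinset (K : ℕ) (lam : ℕ → ℕ) (n : ℕ) :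
    Finset (Fin K × Fin K → Finset ℕ) :=
  {T ∈ Fintype.piFinset fun _ => (range n).powerset | IsSVT lam T}

/-- The weight `b ^ (|T| - |lam|)`, boxwise. -/
def svtWeight {K : ℕ} (b : ℚ) (T : Fin K × Fin K → Finset ℕ) : ℚ :=
  ∏ p, b ^ ((T p).card - 1)

lemma mem_svtFinset {K n : ℕ} {lam : ℕ → ℕ} {T : Fin K × Fin K → Finset ℕ} :
    T ∈ svtFinset K lam n ↔ (∀ p, ∀ a ∈ T p, a < n) ∧ IsSVT lam T := by
  simp [svtFinset, subset_iff]

lemma IsSVT.le_of_mem {K : ℕ} {lam : ℕ → ℕ} {T : Fin K × Fin K → Finset ℕ}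
    (hT : IsSVT lam T) (hlam : Antitone lam) :
    ∀ (i : ℕ) (p : Fin K × Fin K), p.1.val = i → ∀ a ∈ T p, i ≤ a := by
  intro i
  induction i with
  | zero => intros; omega
  | succ i ih =>
    intro p hp a ha
    have hbox : p.2.val < lam p.1.val := by
      by_contra h
      simp [hT.empty p h] at ha
    have hi : i < K := by have := p.1.isLt; omega
    have hle : lam p.1.val ≤ lam i := hlam (by omega)
    obtain ⟨c, hc⟩ := hT.nonempty (⟨i, hi⟩, p.2) (lt_of_lt_of_le hbox hle)
    have h1 := ih (⟨i, hi⟩, p.2) rfl c hc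
    have h2 := hT.col (⟨i, hi⟩, p.2) p hp rfl c hc a ha
    omega

/-- Extension of a finite sequence by zero. -/
def extendZero {n : ℕ} (mu : Fin n → ℕ) (i : ℕ) : ℕ := if h : i < n then mu ⟨i, h⟩ else 0

lemma extendZero_val {n : ℕ} (mu : Fin n → ℕ) (i : Fin n) : extendZero mu i = mu i := by
  simp [extendZero]

lemma extendZero_of_le {n : ℕ} (mu : Fin n → ℕ) {i : ℕ} (h : n ≤ i) : extendZero mu i = 0 := by
  simp [extendZero, not_lt.mpr h]

/-- The sequences interlacing with `lam`. -/
def interlacing (lam : ℕ → ℕ) (n : ℕ) : Finset (Fin n → ℕ) :=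
  Fintype.piFinset fun i : Fin n => Icc (lam (i + 1)) (lam i)

lemma mem_interlacing {lam : ℕ → ℕ} {n : ℕ} {mu : Fin n → ℕ}
    (hlam : ∀ i, n < i → lam i = 0) :
    mu ∈ interlacing lam n ↔
      ∀ i, lam (i + 1) ≤ extendZero mu i ∧ extendZero mu i ≤ lam i := by
  simp only [interlacing, Fintype.mem_piFinset, mem_Icc]
  constructor
  · intro h i
    by_cases hi : i < n
    · simpa [extendZero, hi] using h ⟨i, hi⟩
    · simp [extendZero, hi, hlam (i + 1) (by omega)]
  · intro h i
    simpa [extendZero] using h i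

lemma antitone_of_interlaces {lam mu : ℕ → ℕ} (h : ∀ i, lam (i + 1) ≤ mu i ∧ mu i ≤ lam i) :
    Antitone mu :=
  antitone_nat_of_succ_le fun i => (h (i + 1)).2.trans (h i).1

/-- Fill the boxes of `lam / mu` with `{n}` and add `n` to the boxes in `S`. -/
def addTop {K : ℕ} (lam mu : ℕ → ℕ) (n : ℕ) (S : Finset (Fin K × Fin K))
    (T : Fin K × Fin K → Finset ℕ) (p : Fin K × Fin K) : Finset ℕ :=
  T p ∪ if (mu p.1.val ≤ p.2.val ∧ p.2.val < lam p.1.val) ∨ p ∈ S then {n} else ∅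

lemma mem_addTop {K : ℕ} {lam mu : ℕ → ℕ} {n : ℕ} {S : Finset (Fin K × Fin K)}
    {T : Fin K × Fin K → Finset ℕ} {p : Fin K × Fin K} {a : ℕ} :
    a ∈ addTop lam mu n S T p ↔ a ∈ T p ∨
      (a = n ∧ ((mu p.1.val ≤ p.2.val ∧ p.2.val < lam p.1.val) ∨ p ∈ S)) := by
  unfold addTop
  split_ifs with h <;> simp [h, or_comm]

/-- The row ends of `mu` to which a largest entry may be added inside `lam`. -/
def rowEnds (K : ℕ) (lam mu : ℕ → ℕ) : Finset (Fin K × Fin K) :=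
  {p | p.2.val + 1 = mu p.1.val ∧ lam (p.1.val + 1) < mu p.1.val}

lemma mem_rowEnds {K : ℕ} {lam mu : ℕ → ℕ} {p : Fin K × Fin K} :
    p ∈ rowEnds K lam mu ↔ p.2.val + 1 = mu p.1.val ∧ lam (p.1.val + 1) < mu p.1.val := by
  simp [rowEnds]

lemma addTop_mem {K n : ℕ} {lam mu : ℕ → ℕ} {S : Finset (Fin K × Fin K)}
    {T : Fin K × Fin K → Finset ℕ} (h : ∀ i, lam (i + 1) ≤ mu i ∧ mu i ≤ lam i)
    (hT : T ∈ svtFinset K mu n) (hS : S ⊆ rowEnds K lam mu) :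
    addTop lam mu n S T ∈ svtFinset K lam (n + 1) := by
  rw [mem_svtFinset] at hT ⊢
  obtain ⟨hn, hT⟩ := hT
  have hmem : ∀ p, ∀ a ∈ T p, p.2.val < mu p.1.val := by
    intro p a ha
    by_contra h
    simp [hT.empty p h] at ha
  have hS' : ∀ p ∈ S, p.2.val + 1 = mu p.1.val ∧ lam (p.1.val + 1) < mu p.1.val :=
    fun p hp => mem_rowEnds.1 (hS hp)
  refine ⟨fun p a ha => ?_, fun p hp => ?_, fun p hp => ?_, fun p q h1 h2 a ha c hc => ?_,
    fun p q h1 h2 a ha c hc => ?_⟩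
  · rcases mem_addTop.1 ha with h | ⟨rfl, -⟩
    · exact (hn p a h).trans (Nat.lt_succ_self n)
    · exact Nat.lt_succ_self _
  · by_cases hp' : p.2.val < mu p.1.val
    · obtain ⟨a, ha⟩ := hT.nonempty p hp'
      exact ⟨a, mem_addTop.2 (Or.inl ha)⟩
    · exact ⟨n, mem_addTop.2 (Or.inr ⟨rfl, Or.inl ⟨by omega, hp⟩⟩)⟩
  · refine eq_empty_of_forall_notMem fun a ha => ?_
    have := h p.1.val
    rcases mem_addTop.1 ha with h | ⟨rfl, h | h⟩
    · have := hmem p a h; omega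
    · omega
    · have := hS' p h; omega
  · rcases mem_addTop.1 hc with hc | ⟨rfl, -⟩
    · have hq := hmem q c hc
      rw [h1] at hq
      rcases mem_addTop.1 ha with ha | ⟨rfl, ha | ha⟩
      · exact hT.row p q h1 h2 a ha c hc
      · omega
      · have := hS' p ha; omega
    · rcases mem_addTop.1 ha with ha | ⟨rfl, -⟩
      · exact (hn p a ha).le
      · exact le_rfl
  · have hq : q.2.val < lam (p.1.val + 1) := by
      have := h q.1.val
      rw [← h1]
      rcases mem_addTop.1 hc with hc | ⟨-, hc | hc⟩
      · have := hmem q c hc; omega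
      · omega
      · have := hS' q hc; omega
    have := h p.1.val
    rw [h2] at hq
    rcases mem_addTop.1 ha with hap | ⟨rfl, ha | ha⟩
    · rcases mem_addTop.1 hc with hc | ⟨rfl, -⟩
      · exact hT.col p q h1 h2 a hap c hc
      · exact hn p a hap
    · omega
    · have := hS' p ha; omega

lemma svtWeight_addTop {K n : ℕ} {lam mu : ℕ → ℕ} {S : Finset (Fin K × Fin K)}
    {T : Fin K × Fin K → Finset ℕ} (b : ℚ)
    (hT : T ∈ svtFinset K mu n) (hS : S ⊆ rowEnds K lam mu) :
    svtWeight b (addTop lam mu n S T) = b ^ S.card * svtWeight b T := by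
  obtain ⟨hn, hT⟩ := mem_svtFinset.1 hT
  have hS' : b ^ S.card = ∏ p, b ^ (if p ∈ S then 1 else 0) := by
    rw [prod_pow_eq_pow_sum]; simp
  rw [hS', svtWeight, svtWeight, ← prod_mul_distrib]
  refine prod_congr rfl fun p _ => ?_
  rw [← pow_add]
  congr 1
  have hnot : n ∉ T p := fun h => lt_irrefl _ (hn p n h)
  by_cases hp : p ∈ S
  · have := mem_rowEnds.1 (hS hp)
    have hpos := (hT.nonempty p (by omega)).card_pos
    simp only [addTop, hp, or_true, if_true]
    rw [union_comm, ← insert_eq, card_insert_of_notMem hnot]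
    omega
  · by_cases hbox : mu p.1.val ≤ p.2.val ∧ p.2.val < lam p.1.val
    · simp [addTop, hp, hbox, hT.empty p (by omega)]
    · simp [addTop, hp, hbox]

lemma exists_lt_iff_of_downward {K : ℕ} (P : Fin K → Prop)
    (hP : ∀ i j : Fin K, j.val = i.val + 1 → P j → P i) :
    ∃ c, c ≤ K ∧ ∀ j, P j ↔ j.val < c := by
  classical
  by_cases h : ∃ c, ∃ hc : c < K, ¬ P ⟨c, hc⟩
  · refine ⟨Nat.find h, (Nat.find_spec h).1.le, fun j => ⟨fun hj => ?_, fun hj => ?_⟩⟩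
    · by_contra hlt
      obtain ⟨hc, hnot⟩ := Nat.find_spec h
      apply hnot
      have key : ∀ d, ∀ hd : Nat.find h + d < K, P ⟨Nat.find h + d, hd⟩ → P ⟨Nat.find h, hc⟩ := by
        intro d
        induction d with
        | zero => exact fun _ h => h
        | succ d ih => exact fun hd hPd => ih (by omega) (hP _ _ (by simp; omega) hPd)
      refine key (j.val - Nat.find h) (by omega) ?_
      convert hj using 1
      ext
      simp only
      omega
    · by_contra hnot
      exact Nat.find_min h hj ⟨j.isLt, hnot⟩
  · push Not at h
    exact ⟨K, le_rfl, fun j => ⟨fun _ => j.isLt, fun _ => h j j.isLt⟩⟩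

lemma exists_addTop_eq {K n : ℕ} {lam : ℕ → ℕ} (hlam : Antitone lam)
    (hn : ∀ i, n < i → lam i = 0) (hK : ∀ i, K ≤ i → lam i = 0) (h0 : lam 0 ≤ K)
    {T : Fin K × Fin K → Finset ℕ} (hmemT : T ∈ svtFinset K lam (n + 1)) :
    ∃ mu ∈ interlacing lam n, ∃ T' ∈ svtFinset K (extendZero mu) n,
      ∃ S ⊆ rowEnds K lam (extendZero mu), addTop lam (extendZero mu) n S T' = T := by
  obtain ⟨hlt, hT⟩ := mem_svtFinset.1 hmemT
  have hmem : ∀ p, ∀ a ∈ T p, p.2.val < lam p.1.val := by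
    intro p a ha
    by_contra h
    simp [hT.empty p h] at ha
  have hex : ∀ i : ℕ, ∃ c, c ≤ K ∧
      ∀ hi : i < K, ∀ j : Fin K, (∃ a ∈ T (⟨i, hi⟩, j), a < n) ↔ j.val < c := by
    intro i
    by_cases hi : i < K
    · obtain ⟨c, hc, h⟩ := exists_lt_iff_of_downward
        (fun j : Fin K => ∃ a ∈ T (⟨i, hi⟩, j), a < n) (by
          rintro j j' hj ⟨a, ha, han⟩
          have hb := hmem _ a ha
          simp only at hb
          obtain ⟨c, hc⟩ := hT.nonempty (⟨i, hi⟩, j) (by simp only; omega)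
          exact ⟨c, hc, (hT.row (⟨i, hi⟩, j) (⟨i, hi⟩, j') rfl hj c hc a ha).trans_lt han⟩)
      exact ⟨c, hc, fun _ => h⟩
    · exact ⟨0, Nat.zero_le _, fun h => absurd h hi⟩
  choose c hcK hc using hex
  have hcp : ∀ p : Fin K × Fin K, (∃ a ∈ T p, a < n) ↔ p.2.val < c p.1.val :=
    fun p => hc p.1.val p.1.isLt p.2
  let mu : Fin n → ℕ := fun i => if i.val < K then c i else 0
  have hmu : ∀ p : Fin K × Fin K, p.2.val < extendZero mu p.1.val ↔ ∃ a ∈ T p, a < n := by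
    intro p
    rw [hcp]
    by_cases hp : p.1.val < n
    · simp [extendZero, hp, mu]
    · rw [extendZero_of_le mu (not_lt.1 hp), ← hcp]
      refine ⟨fun h => absurd h (Nat.not_lt_zero _), fun ⟨a, ha, han⟩ => ?_⟩
      have := hT.le_of_mem hlam _ p rfl a ha
      omega
  have hmuK : ∀ i, K ≤ i → extendZero mu i = 0 := by
    intro i hi
    by_cases h : i < n
    · simp [extendZero, h, mu, not_lt.2 hi]
    · exact extendZero_of_le mu (not_lt.1 h)
  have hmule : ∀ i, extendZero mu i ≤ K := by
    intro i
    unfold extendZero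
    split_ifs with h
    · simp only [mu]; split_ifs
      · exact hcK _
      · exact Nat.zero_le _
    · exact Nat.zero_le _
  have hinter : ∀ i, lam (i + 1) ≤ extendZero mu i ∧ extendZero mu i ≤ lam i := by
    intro i
    by_cases hi : i < K
    · constructor
      · by_contra! hlt'
        have hi1 : i + 1 < K := by
          by_contra h
          rw [hK (i + 1) (by omega)] at hlt'
          omega
        have hj : extendZero mu i < K := by
          have := hlam (Nat.zero_le (i + 1)); omega
        have h1 := hmu (⟨i, hi⟩, ⟨extendZero mu i, hj⟩)
        simp only [lt_irrefl, false_iff] at h1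
        apply h1
        obtain ⟨a, ha⟩ := hT.nonempty (⟨i, hi⟩, ⟨extendZero mu i, hj⟩)
          (lt_of_lt_of_le hlt' (hlam (Nat.le_succ i)))
        obtain ⟨d, hd⟩ := hT.nonempty (⟨i + 1, hi1⟩, ⟨extendZero mu i, hj⟩) hlt'
        have h2 := hT.col (⟨i, hi⟩, ⟨extendZero mu i, hj⟩) (⟨i + 1, hi1⟩, ⟨extendZero mu i, hj⟩)
          rfl rfl a ha d hd
        exact ⟨a, ha, by have := hlt _ d hd; omega⟩
      · by_contra! hlt'
        have hj : lam i < K := lt_of_lt_of_le hlt' (hmule i)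
        obtain ⟨a, ha, -⟩ := (hmu (⟨i, hi⟩, ⟨lam i, hj⟩)).1 hlt'
        exact lt_irrefl _ (hmem _ a ha)
    · rw [hmuK i (by omega), hK i (by omega), hK (i + 1) (by omega)]
      simp
  have hnend : ∀ p, n ∈ T p → p.2.val < extendZero mu p.1.val →
      p ∈ rowEnds K lam (extendZero mu) := by
    intro p hp hlt'
    rw [mem_rowEnds]
    have hi := p.1.isLt
    have hj := p.2.isLt
    have hend : p.2.val + 1 = extendZero mu p.1.val := by
      by_contra hne
      have hj' : p.2.val + 1 < K := by have := hmule p.1.val; omega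
      obtain ⟨a, ha, han⟩ := (hmu (p.1, ⟨p.2.val + 1, hj'⟩)).1 (by simp only; omega)
      have := hT.row p (p.1, ⟨p.2.val + 1, hj'⟩) rfl rfl n hp a ha
      omega
    refine ⟨hend, ?_⟩
    by_contra hle
    have hi' : p.1.val + 1 < K := by
      by_contra h
      rw [hK (p.1.val + 1) (by omega)] at hle
      omega
    obtain ⟨d, hd⟩ := hT.nonempty (⟨p.1.val + 1, hi'⟩, p.2) (by simp only; omega)
    have h1 := hT.col p (⟨p.1.val + 1, hi'⟩, p.2) rfl rfl n hp d hd
    have := hlt _ d hd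
    omega
  refine ⟨mu, (mem_interlacing hn).2 hinter, fun p => (T p).erase n,
    mem_svtFinset.2 ⟨fun p a ha => ?_, fun p hp => ?_, fun p hp => ?_,
      fun p q h1 h2 a ha d hd => ?_, fun p q h1 h2 a ha d hd => ?_⟩,
    univ.filter fun p => n ∈ T p ∧ p.2.val < extendZero mu p.1.val, fun p hp => ?_, ?_⟩
  · have := hlt p a (mem_of_mem_erase ha)
    have := ne_of_mem_erase ha
    omega
  · obtain ⟨a, ha, han⟩ := (hmu p).1 hp
    exact ⟨a, mem_erase.2 ⟨han.ne, ha⟩⟩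
  · refine eq_empty_of_forall_notMem fun a ha => hp ((hmu p).2 ⟨a, mem_of_mem_erase ha, ?_⟩)
    have := hlt p a (mem_of_mem_erase ha)
    have := ne_of_mem_erase ha
    omega
  · exact hT.row p q h1 h2 a (mem_of_mem_erase ha) d (mem_of_mem_erase hd)
  · exact hT.col p q h1 h2 a (mem_of_mem_erase ha) d (mem_of_mem_erase hd)
  · rw [mem_filter] at hp
    exact hnend p hp.2.1 hp.2.2
  · funext p
    ext a
    simp only [mem_addTop, mem_erase, mem_filter, mem_univ, true_and]
    by_cases ha : a = n
    · subst ha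
      simp only [ne_eq, not_true_eq_false, false_and, true_and, false_or]
      constructor
      · rintro (⟨h1, h2⟩ | ⟨h, -⟩)
        · obtain ⟨d, hd⟩ := hT.nonempty p h2
          have hnd : ¬ d < a := fun h => absurd ((hmu p).2 ⟨d, hd, h⟩) (by omega)
          have := hlt p d hd
          obtain rfl : d = a := by omega
          exact hd
        · exact h
      · intro h
        by_cases hp : p.2.val < extendZero mu p.1.val
        · exact Or.inr ⟨h, hp⟩
        · exact Or.inl ⟨by omega, hmem p a h⟩
    · simp [ha]

lemma addTop_injective {K n : ℕ} {lam : ℕ → ℕ}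
    (hn : ∀ i, n < i → lam i = 0) (hK : ∀ i, K ≤ i → lam i = 0) (hle : ∀ i, lam i ≤ K)
    {mu mu' : Fin n → ℕ} (hmu : mu ∈ interlacing lam n) (hmu' : mu' ∈ interlacing lam n)
    {T T' : Fin K × Fin K → Finset ℕ} (hT : T ∈ svtFinset K (extendZero mu) n)
    (hT' : T' ∈ svtFinset K (extendZero mu') n) {S S' : Finset (Fin K × Fin K)}
    (hS : S ⊆ rowEnds K lam (extendZero mu)) (hS' : S' ⊆ rowEnds K lam (extendZero mu'))
    (h : addTop lam (extendZero mu) n S T = addTop lam (extendZero mu') n S' T') :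
    mu = mu' ∧ T = T' ∧ S = S' := by
  rw [mem_interlacing hn] at hmu hmu'
  obtain ⟨hlt, hT⟩ := mem_svtFinset.1 hT
  obtain ⟨hlt', hT'⟩ := mem_svtFinset.1 hT'
  have hmem : ∀ p a, (a ∈ T p ∨ (a = n ∧ ((extendZero mu p.1.val ≤ p.2.val ∧
      p.2.val < lam p.1.val) ∨ p ∈ S))) ↔ (a ∈ T' p ∨ (a = n ∧ ((extendZero mu' p.1.val ≤ p.2.val ∧
      p.2.val < lam p.1.val) ∨ p ∈ S'))) := by
    intro p a
    rw [← mem_addTop, ← mem_addTop, h]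
  have hTT : T = T' := by
    funext p
    ext a
    have := hmem p a
    constructor
    · intro ha
      have := hlt p a ha
      rcases (hmem p a).1 (Or.inl ha) with h | h
      · exact h
      · omega
    · intro ha
      have := hlt' p a ha
      rcases (hmem p a).2 (Or.inl ha) with h | h
      · exact h
      · omega
  subst hTT
  have hbox : ∀ p : Fin K × Fin K,
      p.2.val < extendZero mu p.1.val ↔ p.2.val < extendZero mu' p.1.val := by
    intro p
    constructor
    · intro hp
      by_contra hnot
      exact (hT.nonempty p hp).ne_empty (hT'.empty p hnot)
    · intro hp
      by_contra hnot
      exact (hT'.nonempty p hp).ne_empty (hT.empty p hnot)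
  have hmm : mu = mu' := by
    funext i
    rw [← extendZero_val mu, ← extendZero_val mu']
    have h1 := hmu i
    have h2 := hmu' i
    by_cases hi : i.val < K
    · have h3 := hle i
      by_contra hne
      rcases Nat.lt_or_gt_of_ne hne with hlt | hlt
      · have := hbox (⟨i, hi⟩, ⟨extendZero mu i, by omega⟩)
        simp only at this
        omega
      · have := hbox (⟨i, hi⟩, ⟨extendZero mu' i, by omega⟩)
        simp only at this
        omega
    · have := hK i (by omega)
      omega
  subst hmm
  refine ⟨rfl, rfl, ?_⟩
  have key : ∀ {S S' : Finset (Fin K × Fin K)}, S ⊆ rowEnds K lam (extendZero mu) →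
      (∀ p a, (a ∈ T p ∨ (a = n ∧ ((extendZero mu p.1.val ≤ p.2.val ∧
      p.2.val < lam p.1.val) ∨ p ∈ S))) ↔ (a ∈ T p ∨ (a = n ∧ ((extendZero mu p.1.val ≤ p.2.val ∧
      p.2.val < lam p.1.val) ∨ p ∈ S')))) → S ⊆ S' := by
    intro S S' hS hmem p hp
    have hend := mem_rowEnds.1 (hS hp)
    rcases (hmem p n).1 (Or.inr ⟨rfl, Or.inr hp⟩) with h | ⟨-, h | h⟩
    · exact absurd (hlt p n h) (lt_irrefl n)
    · omega
    · exact h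
  exact Subset.antisymm (key hS hmem) (key hS' fun p a => (hmem p a).symm)

lemma pow_card_rowEnds {K n : ℕ} {lam : ℕ → ℕ} (x : ℚ)
    (hn : ∀ i, n < i → lam i = 0) (hK : ∀ i, K ≤ i → lam i = 0) (hle : ∀ i, lam i ≤ K)
    {mu : Fin n → ℕ} (hmu : mu ∈ interlacing lam n) :
    x ^ (rowEnds K lam (extendZero mu)).card
      = ∏ i : Fin n, if lam (i + 1) < mu i then x else 1 := by
  rw [mem_interlacing hn] at hmu
  rw [← prod_filter, prod_const]
  congr 1
  have hrow : ∀ p ∈ rowEnds K lam (extendZero mu), p.1.val < n := by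
    intro p hp
    by_contra h
    have h1 := (mem_rowEnds.1 hp).1
    rw [extendZero_of_le mu (not_lt.1 h)] at h1
    omega
  refine card_bij (fun p hp => ⟨p.1.val, hrow p hp⟩) (fun p hp => ?_) (fun p hp q hq h => ?_)
    (fun i hi => ?_)
  · rw [mem_filter]
    refine ⟨mem_univ _, ?_⟩
    rw [← extendZero_val mu]
    exact (mem_rowEnds.1 hp).2
  · have h1 := (mem_rowEnds.1 hp).1
    have h2 := (mem_rowEnds.1 hq).1
    have h3 : p.1.val = q.1.val := by simpa using h
    rw [h3] at h1
    ext
    · exact h3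
    · omega
  · rw [mem_filter, ← extendZero_val mu] at hi
    have h1 := hmu i
    have h2 := hle i
    have hiK : i.val < K := by
      by_contra h
      have := hK i (by omega)
      omega
    refine ⟨(⟨i, hiK⟩, ⟨extendZero mu i - 1, by omega⟩), mem_rowEnds.2 ⟨?_, hi.2⟩, rfl⟩
    simp only
    omega

/-- Branching rule for set-valued tableaux. -/
theorem sum_svtWeight_succ {K n : ℕ} {lam : ℕ → ℕ} (b : ℚ) (hlam : Antitone lam)
    (hn : ∀ i, n < i → lam i = 0) (hK : ∀ i, K ≤ i → lam i = 0) (h0 : lam 0 ≤ K) :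
    ∑ T ∈ svtFinset K lam (n + 1), svtWeight b T
      = ∑ mu ∈ interlacing lam n, (∏ i : Fin n, if lam (i + 1) < mu i then 1 + b else 1) *
          ∑ T ∈ svtFinset K (extendZero mu) n, svtWeight b T := by
  have hle : ∀ i, lam i ≤ K := fun i => (hlam (Nat.zero_le i)).trans h0
  have hexp : ∀ mu ∈ interlacing lam n,
      (∏ i : Fin n, if lam (i + 1) < mu i then 1 + b else 1) *
          ∑ T ∈ svtFinset K (extendZero mu) n, svtWeight b T
      = ∑ x ∈ svtFinset K (extendZero mu) n ×ˢ (rowEnds K lam (extendZero mu)).powerset,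
          b ^ x.2.card * svtWeight b x.1 := by
    intro mu hmu
    rw [← pow_card_rowEnds (1 + b) hn hK hle hmu, sum_product_right, add_comm 1 b,
      ← sum_pow_mul_eq_add_pow, sum_mul]
    refine sum_congr rfl fun S _ => ?_
    rw [one_pow, mul_one, mul_sum]
  rw [sum_congr rfl hexp, sum_sigma']
  symm
  refine sum_bij (fun x _ => addTop lam (extendZero x.1) n x.2.2 x.2.1) ?_ ?_ ?_ ?_
  · rintro ⟨mu, T, S⟩ hx
    simp only [mem_sigma, mem_product, mem_powerset] at hx
    exact addTop_mem ((mem_interlacing hn).1 hx.1) hx.2.1 hx.2.2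
  · rintro ⟨mu, T, S⟩ hx ⟨mu', T', S'⟩ hx' h
    simp only [mem_sigma, mem_product, mem_powerset] at hx hx'
    obtain ⟨rfl, rfl, rfl⟩ :=
      addTop_injective hn hK hle hx.1 hx'.1 hx.2.1 hx'.2.1 hx.2.2 hx'.2.2 h
    rfl
  · intro T hT
    obtain ⟨mu, hmu, T', hT', S, hS, h⟩ := exists_addTop_eq hlam hn hK h0 hT
    exact ⟨⟨mu, T', S⟩, by simpa using ⟨hmu, hT', hS⟩, h⟩
  · rintro ⟨mu, T, S⟩ hx
    simp only [mem_sigma, mem_product, mem_powerset] at hx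
    exact (svtWeight_addTop b hx.2.1 hx.2.2).symm

/-- `(1 + b E) ^ i` applied to `m ↦ (-1) ^ c * binom(m, c)`, with `E` the shift of `m`. -/
def shiftBinom (b : ℚ) : ℕ → ℕ → ℕ → ℚ
  | 0, c, m => (-1) ^ c * (m.choose c : ℚ)
  | i + 1, c, m => shiftBinom b i c m + b * shiftBinom b i c (m + 1)

lemma shiftBinom_col_zero (b : ℚ) (i m : ℕ) : shiftBinom b i 0 m = (1 + b) ^ i := by
  induction i generalizing m with
  | zero => simp [shiftBinom]
  | succ i ih => simp only [shiftBinom, ih]; ring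

lemma shiftBinom_sub (b : ℚ) (i c m : ℕ) :
    shiftBinom b i (c + 1) m - shiftBinom b i (c + 1) (m + 1) = shiftBinom b i c m := by
  induction i generalizing m with
  | zero =>
    simp only [shiftBinom, Nat.choose_succ_succ, Nat.succ_eq_add_one]
    push_cast
    ring
  | succ i ih =>
    simp only [shiftBinom]
    linear_combination ih m + b * ih (m + 1)

lemma sum_Icc_shiftBinom (b : ℚ) (i c r : ℕ) {lo hi : ℕ} (h : lo ≤ hi) :
    ∑ m ∈ Icc lo hi, shiftBinom b i c (m + r)
      = shiftBinom b i (c + 1) (lo + r) - shiftBinom b i (c + 1) (hi + r + 1) := by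
  induction hi, h using Nat.le_induction with
  | base => rw [Icc_self, sum_singleton, shiftBinom_sub]
  | succ hi h ih =>
    rw [sum_Icc_succ_top (by omega), ih, ← shiftBinom_sub b i c (hi + 1 + r),
      show hi + 1 + r = hi + r + 1 by omega]
    ring

lemma sum_Icc_weighted_shiftBinom (b : ℚ) (i c r : ℕ) {lo hi : ℕ} (h : lo ≤ hi) :
    ∑ m ∈ Icc lo hi, (if lo < m then 1 + b else 1) * shiftBinom b i c (m + r)
      = shiftBinom b (i + 1) (c + 1) (lo + r) - (1 + b) * shiftBinom b i (c + 1) (hi + r + 1) := by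
  have h1 : ∀ m ∈ Icc lo hi, (if lo < m then 1 + b else 1) * shiftBinom b i c (m + r)
      = (1 + b) * shiftBinom b i c (m + r)
        - if lo = m then b * shiftBinom b i c (m + r) else 0 := by
    intro m hm
    rw [mem_Icc] at hm
    rcases hm.1.eq_or_lt with rfl | hlt
    · simp only [lt_irrefl, if_false, if_true]; ring
    · simp [hlt, hlt.ne]
  rw [sum_congr rfl h1, sum_sub_distrib, ← mul_sum, sum_Icc_shiftBinom b i c r h, sum_ite_eq,
    if_pos (left_mem_Icc.2 h), ← shiftBinom_sub b i c (lo + r)]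
  simp only [shiftBinom]
  ring

/-- The matrix whose determinant is the bialternant for `lam` at `x = (1, …, 1)`. -/
def bialternantMatrix (b : ℚ) (lam : ℕ → ℕ) (n : ℕ) : Matrix (Fin n) (Fin n) ℚ :=
  Matrix.of fun i c => shiftBinom b i c (lam i + (n - 1 - i))

/-- Branching rule for the bialternant. -/
theorem det_bialternantMatrix_succ (b : ℚ) {lam : ℕ → ℕ} (hlam : Antitone lam) (n : ℕ) :
    (bialternantMatrix b lam (n + 1)).det
      = ∑ mu ∈ interlacing lam n, (∏ i : Fin n, if lam (i + 1) < mu i then 1 + b else 1) *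
          (bialternantMatrix b (extendZero mu) n).det := by
  have hrhs : ∀ mu : Fin n → ℕ, (∏ i : Fin n, if lam (i + 1) < mu i then 1 + b else 1) *
      (bialternantMatrix b (extendZero mu) n).det
      = (Matrix.detRowAlternating (R := ℚ) (n := Fin n)).toMultilinearMap (fun i =>
        (if lam (i + 1) < mu i then 1 + b else 1) •
          fun c : Fin n => shiftBinom b i c (mu i + (n - 1 - i))) := by
    intro mu
    rw [MultilinearMap.map_smul_univ, smul_eq_mul]
    congr 1
    change _ = Matrix.det _
    congr 1
    ext i c
    simp [bialternantMatrix, extendZero_val]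
  rw [sum_congr rfl fun mu _ => hrhs mu, interlacing,
    ← MultilinearMap.map_sum_finset (Matrix.detRowAlternating (R := ℚ) (n := Fin n)).toMultilinearMap
      (fun (i : Fin n) (m : ℕ) => (if lam (i + 1) < m then 1 + b else 1) •
          fun c : Fin n => shiftBinom b i c (m + (n - 1 - i)))]
  change _ = Matrix.det _
  let M := bialternantMatrix b lam (n + 1)
  let B : Matrix (Fin (n + 1)) (Fin (n + 1)) ℚ :=
    Matrix.of (Fin.cons (M 0) fun i : Fin n => M i.succ - (1 + b) • M i.castSucc)
  have hdet : M.det = B.det := by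
    refine Matrix.det_eq_of_forall_row_eq_smul_add_pred (fun _ => 1 + b) (fun j => ?_)
      (fun i j => ?_)
    · simp [B]
    · simp [B]
  change M.det = _
  have hcol : ∀ i : Fin n, B i.succ 0 = 0 := by
    intro i
    simp [B, M, bialternantMatrix, shiftBinom_col_zero]
    ring
  have hB0 : B 0 0 = 1 := by
    simp [B, M, bialternantMatrix, shiftBinom_col_zero]
  rw [hdet, Matrix.det_succ_column_zero, Fin.sum_univ_succ]
  simp only [hcol, hB0, mul_zero, zero_mul, sum_const_zero, add_zero, Fin.val_zero, pow_zero,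
    mul_one, one_mul]
  congr 1
  ext i c
  simp only [Matrix.submatrix_apply, Finset.sum_apply, Pi.smul_apply, smul_eq_mul]
  rw [sum_Icc_weighted_shiftBinom b i c _ (hlam (Nat.le_succ i))]
  have hi := i.isLt
  simp only [Fin.succAbove_zero, Matrix.of_apply, Fin.cons_succ, Pi.sub_apply, Pi.smul_apply,
    smul_eq_mul, bialternantMatrix, Fin.val_succ, Fin.val_castSucc, M, B]
  rw [show lam i.val + (n - 1 - i.val) + 1 = lam i.val + (n + 1 - 1 - i.val) by omega,
    show n - 1 - i.val = n + 1 - 1 - (i.val + 1) by omega]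

lemma shiftBinom_eq_sum (b : ℚ) (i c m : ℕ) :
    shiftBinom b i c m
      = ∑ k ∈ range (i + 1), (i.choose k : ℚ) * b ^ k * shiftBinom b 0 c (m + k) := by
  induction i generalizing m with
  | zero => simp
  | succ i ih =>
    rw [shiftBinom, ih, ih, sum_range_succ' _ (i + 1)]
    simp only [Nat.choose_succ_succ, Nat.succ_eq_add_one, Nat.cast_add, add_mul, sum_add_distrib]
    rw [sum_range_succ (fun k => ((i.choose (k + 1) : ℕ) : ℚ) * b ^ (k + 1) *
      shiftBinom b 0 c (m + (k + 1))), sum_range_succ' _ i, mul_sum]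
    simp only [Nat.choose_succ_self, Nat.cast_zero, zero_mul, add_zero, Nat.choose_zero_right]
    rw [show ∑ k ∈ range (i + 1), b * ((i.choose k : ℚ) * b ^ k * shiftBinom b 0 c (m + 1 + k))
      = ∑ k ∈ range (i + 1), (i.choose k : ℚ) * b ^ (k + 1) * shiftBinom b 0 c (m + (k + 1)) from
      sum_congr rfl fun k _ => by rw [show m + 1 + k = m + (k + 1) by ring]; ring]
    ring

lemma prod_filter_lt_eq {n : ℕ} (f : Fin n → Fin n → ℚ) :
    ∏ p ∈ univ.filter (fun p : Fin n × Fin n => p.1 < p.2), f p.1 p.2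
      = ∏ i, ∏ j ∈ Ioi i, f i j := by
  rw [prod_sigma']
  refine prod_bij' (fun p _ => ⟨p.1, p.2⟩) (fun p _ => (p.1, p.2)) ?_ ?_ ?_ ?_ ?_ <;> simp

lemma det_shiftBinom_zero (b : ℚ) {n : ℕ} (v : Fin n → ℕ) :
    (∏ c : Fin n, (c.val.factorial : ℚ)) *
        (Matrix.of fun i c : Fin n => shiftBinom b 0 c (v i)).det
      = ∏ p ∈ univ.filter (fun p : Fin n × Fin n => p.1 < p.2), ((v p.1 : ℚ) - v p.2) := by
  rw [prod_filter_lt_eq (fun i j => (v i : ℚ) - v j), ← Matrix.det_mul_row]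
  have h := Matrix.det_eval_matrixOfPolynomials_eq_det_vandermonde (fun i : Fin n => -(v i : ℚ))
    (fun c => ascPochhammer ℚ c) (fun c => ascPochhammer_natDegree ℚ c)
    (fun c => monic_ascPochhammer ℚ c)
  rw [Matrix.det_vandermonde] at h
  rw [show ∏ i : Fin n, ∏ j ∈ Ioi i, ((v i : ℚ) - v j)
    = ∏ i : Fin n, ∏ j ∈ Ioi i, (-(v j : ℚ) - -(v i : ℚ)) from
    prod_congr rfl fun i _ => prod_congr rfl fun j _ => by ring, h]
  congr 1
  ext i c
  simp only [Matrix.of_apply, ascPochhammer_eval_neg_eq_descPochhammer,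
    descPochhammer_eval_eq_descFactorial, Nat.descFactorial_eq_factorial_mul_choose, shiftBinom]
  push_cast
  ring

theorem holmanF_mul_prod (b : ℚ) (n : ℕ) {lam : ℕ → ℕ} (hlam : Antitone lam) :
    holmanF n lam (-b) * ∏ p ∈ univ.filter (fun p : Fin n × Fin n => p.1 < p.2),
        ((lam (p.1.val + 1) : ℚ) - (lam (p.2.val + 1) : ℚ) + (p.2.val : ℚ) - (p.1.val : ℚ))
      = (∏ c : Fin n, (c.val.factorial : ℚ)) *
          (bialternantMatrix b (fun i => lam (i + 1)) n).det := by
  have hne : ∏ p ∈ univ.filter (fun p : Fin n × Fin n => p.1 < p.2),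
      ((lam (p.1.val + 1) : ℚ) - (lam (p.2.val + 1) : ℚ) + (p.2.val : ℚ) - (p.1.val : ℚ)) ≠ 0 := by
    refine prod_ne_zero_iff.2 fun p hp => ne_of_gt ?_
    have h1 : p.1.val < p.2.val := (mem_filter.1 hp).2
    have h2 : (lam (p.2.val + 1) : ℚ) ≤ lam (p.1.val + 1) := by
      exact_mod_cast hlam (by omega)
    have h3 : (p.1.val : ℚ) < p.2.val := by exact_mod_cast h1
    linarith
  have hrow : bialternantMatrix b (fun i => lam (i + 1)) n
      = fun i : Fin n => ∑ k : Fin (i.val + 1), ((i.val.choose k.val : ℚ) * b ^ k.val) •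
        fun c : Fin n => shiftBinom b 0 c (lam (i.val + 1) + (n - 1 - i.val) + k.val) := by
    ext i c
    simp only [bialternantMatrix, Matrix.of_apply, Finset.sum_apply, Pi.smul_apply, smul_eq_mul]
    rw [shiftBinom_eq_sum, Finset.sum_range]
  have hdet : (bialternantMatrix b (fun i => lam (i + 1)) n).det
      = (Matrix.detRowAlternating (R := ℚ) (n := Fin n)).toMultilinearMap
          (bialternantMatrix b (fun i => lam (i + 1)) n) := rfl
  rw [hdet, hrow, MultilinearMap.map_sum, holmanF, sum_mul, mul_sum]
  refine sum_congr rfl fun κ _ => ?_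
  rw [MultilinearMap.map_smul_univ, smul_eq_mul, prod_div_distrib, neg_neg, prod_mul_distrib,
    prod_pow_eq_pow_sum]
  have h := det_shiftBinom_zero b
    (fun i : Fin n => lam (i.val + 1) + (n - 1 - i.val) + (κ i).val)
  rw [show ∏ p ∈ univ.filter (fun p : Fin n × Fin n => p.1 < p.2),
      (((lam (p.1.val + 1) + (n - 1 - p.1.val) + (κ p.1).val : ℕ) : ℚ) -
        ((lam (p.2.val + 1) + (n - 1 - p.2.val) + (κ p.2).val : ℕ) : ℚ))
      = ∏ p ∈ univ.filter (fun p : Fin n × Fin n => p.1 < p.2),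
        ((lam (p.1.val + 1) : ℚ) - (lam (p.2.val + 1) : ℚ) + (p.2.val : ℚ) - (p.1.val : ℚ)
            + ((κ p.1).val : ℚ) - ((κ p.2).val : ℚ)) from prod_congr rfl fun p _ => by
    have h1 : ((n - 1 - p.1.val : ℕ) : ℚ) = (n : ℚ) - 1 - p.1.val := by
      have := p.1.isLt
      rw [Nat.cast_sub (by omega), Nat.cast_sub (by omega)]
      simp
    have h2 : ((n - 1 - p.2.val : ℕ) : ℚ) = (n : ℚ) - 1 - p.2.val := by
      have := p.2.isLt
      rw [Nat.cast_sub (by omega), Nat.cast_sub (by omega)]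
      simp
    push_cast
    rw [h1, h2]
    ring] at h
  rw [← h]
  change _ = _ * (_ * Matrix.det (Matrix.of fun i c : Fin n =>
    shiftBinom b 0 c (lam (i.val + 1) + (n - 1 - i.val) + (κ i).val)))
  field_simp

theorem sum_svtWeight_eq_det {K : ℕ} (b : ℚ) (n : ℕ) : ∀ {lam : ℕ → ℕ}, Antitone lam →
    (∀ i, n ≤ i → lam i = 0) → (∀ i, K ≤ i → lam i = 0) → lam 0 ≤ K →
    ∑ T ∈ svtFinset K lam n, svtWeight b T = (bialternantMatrix b lam n).det := by
  induction n with
  | zero =>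
    intro lam _ hn _ _
    have h : svtFinset K lam 0 = {fun _ => ∅} := by
      ext T
      rw [mem_svtFinset, mem_singleton]
      constructor
      · rintro ⟨h, -⟩
        funext p
        exact eq_empty_of_forall_notMem fun a ha => absurd (h p a ha) (Nat.not_lt_zero a)
      · rintro rfl
        refine ⟨by simp, fun p hp => ?_, fun p _ => rfl, by simp, by simp⟩
        rw [hn _ (Nat.zero_le _)] at hp
        exact absurd hp (Nat.not_lt_zero _)
    simp [h, svtWeight]
  | succ n ih =>
    intro lam hlam hn hK h0
    have hn' : ∀ i, n < i → lam i = 0 := fun i hi => hn i hi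
    rw [sum_svtWeight_succ b hlam hn' hK h0, det_bialternantMatrix_succ b hlam]
    refine sum_congr rfl fun mu hmu => ?_
    rw [mem_interlacing hn'] at hmu
    rw [ih (antitone_of_interlaces hmu) (fun i hi => extendZero_of_le mu hi)
      (fun i hi => Nat.eq_zero_of_le_zero (hK i hi ▸ (hmu i).2)) ((hmu 0).2.trans h0)]

lemma card_stairBox (k : ℕ) :
    ∑ p : Fin k × Fin k, (if p.2.val < k - (p.1.val + 1) then 1 else 0) = k * (k - 1) / 2 := by
  rw [Fintype.sum_prod_type, ← sum_range_id]
  have h : ∀ i : Fin k, ∑ j : Fin k, (if j.val < k - (i.val + 1) then 1 else 0)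
      = k - 1 - i.val := by
    intro i
    rw [Fin.sum_univ_eq_sum_range (fun j => if j < k - (i.val + 1) then 1 else 0) k,
      ← sum_filter, sum_const, smul_eq_mul, mul_one,
      show (range k).filter (fun j => j < k - (i.val + 1)) = range (k - 1 - i.val) by
        ext j; simp only [mem_filter, mem_range]; omega, card_range]
  simp only [h]
  rw [Fin.sum_univ_eq_sum_range (fun i => k - 1 - i) k, sum_range_reflect (fun i => i) k]

theorem gspecStair_eq_sum_svtWeight (k n : ℕ) (b : ℚ) :
    GspecStair k n b = ∑ T ∈ svtFinset k (fun i => k - (i + 1)) n, svtWeight b T := by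
  classical
  rw [GspecStair, finsum_eq_sum_of_fintype]
  have hbox : ∀ p : Fin k × Fin k, StairBox k p ↔ p.2.val < k - (p.1.val + 1) := by
    intro p; unfold StairBox; omega
  refine sum_bij (fun T _ p => (T.1 p).map Fin.valEmbedding) ?_ ?_ ?_ ?_
  · rintro ⟨T, h1, h2, h3, h4⟩ -
    rw [mem_svtFinset]
    refine ⟨fun p a ha => ?_, fun p hp => ?_, fun p hp => ?_, fun p q hp hq a ha c hc => ?_,
      fun p q hp hq a ha c hc => ?_⟩
    · obtain ⟨x, -, rfl⟩ := mem_map.1 ha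
      exact x.isLt
    · exact (h1 p ((hbox p).2 hp)).map
    · simp only [h2 p (mt (hbox p).1 hp), map_empty]
    · obtain ⟨x, hx, rfl⟩ := mem_map.1 ha
      obtain ⟨y, hy, rfl⟩ := mem_map.1 hc
      exact h3 p q hp hq x hx y hy
    · obtain ⟨x, hx, rfl⟩ := mem_map.1 ha
      obtain ⟨y, hy, rfl⟩ := mem_map.1 hc
      exact h4 p q hp hq x hx y hy
  · rintro ⟨T, hT⟩ - ⟨T', hT'⟩ - h
    refine Subtype.ext (funext fun p => map_injective Fin.valEmbedding (congrFun h p))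
  · intro T hT
    obtain ⟨hlt, hT⟩ := mem_svtFinset.1 hT
    refine ⟨⟨fun p => univ.filter fun x : Fin n => x.val ∈ T p, fun p hp => ?_, fun p hp => ?_,
      fun p q hp hq a ha c hc => ?_, fun p q hp hq a ha c hc => ?_⟩, mem_univ _, ?_⟩
    · obtain ⟨a, ha⟩ := hT.nonempty p ((hbox p).1 hp)
      exact ⟨⟨a, hlt p a ha⟩, by simpa using ha⟩
    · simp [hT.empty p (mt (hbox p).2 hp)]
    · exact hT.row p q hp hq a (mem_filter.1 ha).2 c (mem_filter.1 hc).2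
    · exact hT.col p q hp hq a (mem_filter.1 ha).2 c (mem_filter.1 hc).2
    · funext p
      ext a
      simp only [mem_map, mem_filter, mem_univ, true_and, Fin.valEmbedding_apply]
      exact ⟨fun ⟨x, hx, h⟩ => h ▸ hx, fun ha => ⟨⟨a, hlt p a ha⟩, ha, rfl⟩⟩
  · rintro ⟨T, h1, h2, -, -⟩ -
    rw [svtWeight, prod_pow_eq_pow_sum]
    congr 1
    have h : ∑ p, (T p).card = ∑ p, ((T p).card - 1) + k * (k - 1) / 2 := by
      rw [← card_stairBox, ← sum_add_distrib]
      refine sum_congr rfl fun p _ => ?_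
      split_ifs with hp
      · have := (h1 p ((hbox p).2 hp)).card_pos
        omega
      · simp [h2 p (mt (hbox p).1 hp)]
    simp only [card_map]
    omega

/-- `∏_{i < j} (lam_i - lam_j + j - i)` for the staircase `δ_k`, with `i, j` in `{1, …, n}`. -/
def stairDiffProd (k n : ℕ) : ℚ :=
  ∏ p ∈ univ.filter (fun p : Fin n × Fin n => p.1 < p.2),
    (((k - (p.1.val + 1) : ℕ) : ℚ) - ((k - (p.2.val + 1) : ℕ) : ℚ) + (p.2.val : ℚ) - (p.1.val : ℚ))

lemma gspecStair_mul_prod_factorial {k n : ℕ} (hkn : k ≤ n + 1) (b : ℚ) :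
    GspecStair k n b * ∏ c : Fin n, (c.val.factorial : ℚ)
      = holmanF n (fun i => k - i) (-b) * stairDiffProd k n := by
  have h := holmanF_mul_prod b n (lam := fun i => k - i) (fun i j h => Nat.sub_le_sub_left h k)
  rw [stairDiffProd, h, gspecStair_eq_sum_svtWeight, sum_svtWeight_eq_det b n
    (fun i j h => Nat.sub_le_sub_left (Nat.succ_le_succ h) k)
    (fun i hi => by omega) (fun i hi => by omega) (by omega), mul_comm]

lemma stairDiffProd_succ (k n : ℕ) :
    stairDiffProd k (n + 1) = stairDiffProd k n * ∏ i ∈ range n,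
      (((k - (i + 1) : ℕ) : ℚ) - ((k - (n + 1) : ℕ) : ℚ) + (n : ℚ) - (i : ℚ)) := by
  have key : ∀ m, stairDiffProd k m = ∏ j ∈ range m, ∏ i ∈ range j,
      (((k - (i + 1) : ℕ) : ℚ) - ((k - (j + 1) : ℕ) : ℚ) + (j : ℚ) - (i : ℚ)) := by
    intro m
    let f : ℕ → ℕ → ℚ := fun i j =>
      (((k - (i + 1) : ℕ) : ℚ) - ((k - (j + 1) : ℕ) : ℚ) + (j : ℚ) - (i : ℚ))
    rw [stairDiffProd, prod_filter, Fintype.prod_prod_type_right]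
    simp only [Fin.lt_def]
    rw [Fin.prod_univ_eq_prod_range (fun j => ∏ i : Fin m, if i.val < j then f i j else 1) m]
    refine prod_congr rfl fun j hj => ?_
    rw [Fin.prod_univ_eq_prod_range (fun i => if i < j then f i j else 1) m, ← prod_filter]
    refine prod_congr ?_ fun _ _ => rfl
    ext i
    rw [mem_range] at hj
    simp only [mem_filter, mem_range]
    omega
  rw [key, key, prod_range_succ]

lemma stairDiffProd_succ_succ {k n : ℕ} (hkn : k ≤ n) :
    stairDiffProd k (n + 1) = stairDiffProd k n * ((∏ i ∈ range k, ((n : ℚ) - k + 1 + 2 * i)) *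
      ∏ i ∈ Ico k n, ((n : ℚ) - i)) ∧
    stairDiffProd (k + 1) (n + 1) = stairDiffProd (k + 1) n *
      ((∏ i ∈ range k, (((n + 1 : ℕ) : ℚ) - k + 1 + 2 * i)) * ∏ i ∈ Ico k n, ((n : ℚ) - i)) := by
  rw [stairDiffProd_succ, stairDiffProd_succ, ← prod_range_mul_prod_Ico _ hkn,
    ← prod_range_mul_prod_Ico _ hkn]
  rw [← prod_range_reflect (fun i : ℕ => (n : ℚ) - k + 1 + 2 * i),
    ← prod_range_reflect (fun i : ℕ => ((n + 1 : ℕ) : ℚ) - k + 1 + 2 * i)]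
  refine ⟨?_, ?_⟩ <;> congr 1 <;> congr 1
  · refine prod_congr rfl fun i hi => ?_
    rw [mem_range] at hi
    rw [show k - (n + 1) = 0 by omega, Nat.cast_sub (show i + 1 ≤ k by omega),
      show k - 1 - i = k - (i + 1) by omega, Nat.cast_sub (show i + 1 ≤ k by omega)]
    push_cast
    ring
  · refine prod_congr rfl fun i hi => ?_
    rw [mem_Ico] at hi
    rw [show k - (n + 1) = 0 by omega, show k - (i + 1) = 0 by omega]
    simp
  · refine prod_congr rfl fun i hi => ?_
    rw [mem_range] at hi
    rw [show k + 1 - (n + 1) = 0 by omega, show k + 1 - (i + 1) = k - i by omega,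
      Nat.cast_sub (show i ≤ k by omega),
      show k - 1 - i = k - (i + 1) by omega, Nat.cast_sub (show i + 1 ≤ k by omega)]
    push_cast
    ring
  · refine prod_congr rfl fun i hi => ?_
    rw [mem_Ico] at hi
    rw [show k + 1 - (n + 1) = 0 by omega, show k + 1 - (i + 1) = 0 by omega]
    simp

lemma two_mul_factorial_eq (k : ℕ) :
    ((2 * k).factorial : ℚ) = 2 ^ k * (k.factorial : ℚ) * ∏ j ∈ range k, (1 + 2 * (j : ℚ)) := by
  induction k with
  | zero => simp
  | succ k ih =>
    rw [show 2 * (k + 1) = 2 * k + 1 + 1 by ring, Nat.factorial_succ, Nat.factorial_succ,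
      prod_range_succ, Nat.factorial_succ]
    push_cast
    rw [ih]
    ring

/-- The ratio of the dimensions of adjacent staircase shapes. -/
lemma factorial_mul_stairDiffProd {k n : ℕ} (hkn : k ≤ n) :
    ((2 * k).factorial : ℚ) * stairDiffProd (k + 1) n
      = 2 ^ k * (k.factorial : ℚ) * (∏ j ∈ range k, ((n : ℚ) - k + 1 + 2 * j)) *
          stairDiffProd k n := by
  induction n, hkn using Nat.le_induction with
  | base =>
    have h : stairDiffProd (k + 1) k = stairDiffProd k k := by
      refine prod_congr rfl fun p _ => ?_
      have h1 := p.1.isLt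
      have h2 := p.2.isLt
      rw [show k + 1 - (p.1.val + 1) = k - (p.1.val + 1) + 1 by omega,
        show k + 1 - (p.2.val + 1) = k - (p.2.val + 1) + 1 by omega]
      push_cast
      ring
    rw [h, two_mul_factorial_eq, sub_self]
    simp only [zero_add]
  | succ n hkn ih =>
    obtain ⟨h1, h2⟩ := stairDiffProd_succ_succ hkn
    rw [h1, h2]
    linear_combination ((∏ i ∈ range k, (((n + 1 : ℕ) : ℚ) - k + 1 + 2 * i)) *
      ∏ i ∈ Ico k n, ((n : ℚ) - i)) * ih

lemma jacobiP_neg_one (k : ℕ) (x y : ℚ) :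
    jacobiP k x y (-1) = (-1) ^ k * genBinom (k + y) k := by
  rw [jacobiP, sum_range_succ, sum_eq_zero fun r hr => ?_]
  · simp [genBinom]
    norm_num
    ring
  · rw [mem_range] at hr
    rw [show ((-1 : ℚ) + 1) / 2 = 0 by norm_num, zero_pow (by omega), mul_zero]

lemma factorial_mul_jacobiP_staircase (k n : ℕ) :
    2 ^ k * (k.factorial : ℚ) * jacobiP k (((n : ℚ) - k - 1) / 2) ((-(n : ℚ) - k - 1) / 2) (-1)
      = ∏ j ∈ range k, ((n : ℚ) - k + 1 + 2 * j) := by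
  have hk : (k.factorial : ℚ) ≠ 0 := by exact_mod_cast k.factorial_ne_zero
  have h : ∀ m : ℕ, ∏ j ∈ range m, ((n : ℚ) - k + 1 + 2 * j)
      = 2 ^ m * (-1) ^ m * ∏ j ∈ range m, ((k : ℚ) + (-(n : ℚ) - k - 1) / 2 - j) := by
    intro m
    induction m with
    | zero => simp
    | succ m ih => rw [prod_range_succ, prod_range_succ, ih]; ring
  rw [jacobiP_neg_one, genBinom, h]
  field_simp

end Helpers

/-- For `1 ≤ k ≤ n` and every `β ∈ ℚ`, the specialized stable Grothendieck polynomials of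
adjacent staircase shapes satisfy
`(2k)! · G_{δ_{k+1}}(1,…,1|β) · F^{(n)}_{δ_k}(-β)
  = 2^k k! (∏_{j=0}^{k-1} (n-k+1+2j)) · G_{δ_k}(1,…,1|β) · F^{(n)}_{δ_{k+1}}(-β)`,
where the scalar ratio equals `(2^{2k}(k!)²/(2k)!) · P_k^{(α,β')}(-1)` with
`α = (n-k-1)/2`, `β' = (-n-k-1)/2`. -/
theorem grothendieck_staircase_recurrence (k n : ℕ) (hk : 1 ≤ k) (hkn : k ≤ n) (b : ℚ) :
    ((Nat.factorial (2 * k) : ℚ) * GspecStair (k + 1) n b * holmanF n (fun i => k - i) (-b)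
        = 2 ^ k * (Nat.factorial k : ℚ) *
            (∏ j ∈ Finset.range k, ((n : ℚ) - k + 1 + 2 * j)) *
            GspecStair k n b * holmanF n (fun i => k + 1 - i) (-b)) ∧
      (2 ^ k * (Nat.factorial k : ℚ) *
            (∏ j ∈ Finset.range k, ((n : ℚ) - k + 1 + 2 * j)) / (Nat.factorial (2 * k) : ℚ)
        = 2 ^ (2 * k) * (Nat.factorial k : ℚ) ^ 2 / (Nat.factorial (2 * k) : ℚ) *
            jacobiP k (((n : ℚ) - k - 1) / 2) ((-(n : ℚ) - k - 1) / 2) (-1)) := by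
  have hsf : ∏ c : Fin n, (c.val.factorial : ℚ) ≠ 0 :=
    Finset.prod_ne_zero_iff.2 fun c _ => by exact_mod_cast c.val.factorial_ne_zero
  refine ⟨mul_right_cancel₀ hsf ?_, ?_⟩
  · have h1 := gspecStair_mul_prod_factorial (k := k) (n := n) (by omega) b
    have h2 := gspecStair_mul_prod_factorial (k := k + 1) (n := n) (by omega) b
    have h3 := factorial_mul_stairDiffProd hkn
    linear_combination
      ((2 * k).factorial : ℚ) * holmanF n (fun i => k - i) (-b) * h2
      - 2 ^ k * (k.factorial : ℚ) * (∏ j ∈ Finset.range k, ((n : ℚ) - k + 1 + 2 * j)) *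
          holmanF n (fun i => k + 1 - i) (-b) * h1
      + holmanF n (fun i => k - i) (-b) * holmanF n (fun i => k + 1 - i) (-b) * h3
  · rw [← factorial_mul_jacobiP_staircase k n]
    ring
end

section
/- Let k ≥ 1 and n ≥ k−1 be integers. Then the number of shifted set-valued semistandard tableaux of shifted staircase shape equals the number of set-valued semistandard tableaux of staircase shape: |SSVT_P(δ̃_k, n)| = |SVT(δ_k, n)|. -/
/-- `(i,j)` (0-indexed) is a box of the shifted Young diagram of the shifted staircase
`δ̃_k = (k-1, k-2, …, 1)`: the 1-indexed boxes are `{(i,j) : 1 ≤ i ≤ j ≤ k-1}`. -/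
def ShiftedStairBox (k : ℕ) (p : Fin k × Fin k) : Prop :=
  p.1.val ≤ p.2.val ∧ p.2.val + 2 ≤ k

/-- `T` is a shifted set-valued semistandard tableau of shifted staircase shape `δ̃_k` with
entries in the ordered alphabet `1' < 1 < 2' < 2 < ⋯ < n' < n`, encoded as `Fin (2*n)`
where the value `2s` encodes `(s+1)'` (primed) and `2s+1` encodes `s+1` (unprimed). -/
def IsSSVTPStair (k n : ℕ) (T : Fin k × Fin k → Finset (Fin (2 * n))) : Prop :=
  (∀ p, ShiftedStairBox k p → (T p).Nonempty) ∧
  (∀ p, ¬ ShiftedStairBox k p → T p = ∅) ∧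
  (∀ p q : Fin k × Fin k, q.1 = p.1 → (q.2 : ℕ) = (p.2 : ℕ) + 1 →
    ∀ a ∈ T p, ∀ b ∈ T q, a ≤ b) ∧
  (∀ p q : Fin k × Fin k, (q.1 : ℕ) = (p.1 : ℕ) + 1 → q.2 = p.2 →
    ∀ a ∈ T p, ∀ b ∈ T q, a ≤ b) ∧
  (∀ p q : Fin k × Fin k, p.2 = q.2 → p.1 ≠ q.1 →
    ∀ a ∈ T p, a.val % 2 = 1 → a ∉ T q) ∧
  (∀ p q : Fin k × Fin k, p.1 = q.1 → p.2 ≠ q.2 →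
    ∀ a ∈ T p, a.val % 2 = 0 → a ∉ T q) ∧
  (∀ p : Fin k × Fin k, p.1 = p.2 → ∀ a ∈ T p, a.val % 2 = 1)

open Function

section HeckeProducts

variable {R : Type*} [Ring R] [Algebra ℝ R]

/-- The element `1 + (q - 1) u`; for idempotent `u` it is multiplicative in `q`. -/
def deform (u : R) (q : ℝ) : R := 1 + (q - 1) • u

lemma deform_one (u : R) : deform u 1 = 1 := by simp [deform]

lemma deform_mul {u : R} (hu : u * u = u) (p q : ℝ) :
    deform u p * deform u q = deform u (p * q) := by
  simp only [deform, mul_add, add_mul, one_mul, mul_one, smul_mul_assoc, mul_smul_comm, hu]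
  module

lemma deform_mul_inv {u : R} (hu : u * u = u) {q : ℝ} (hq : q ≠ 0) :
    deform u q * deform u q⁻¹ = 1 := by
  rw [deform_mul hu, mul_inv_cancel₀ hq, deform_one]

lemma deform_inv_mul {u : R} (hu : u * u = u) {q : ℝ} (hq : q ≠ 0) :
    deform u q⁻¹ * deform u q = 1 := by
  rw [deform_mul hu, inv_mul_cancel₀ hq, deform_one]

lemma deform_comm {u v : R} (h : u * v = v * u) (p q : ℝ) :
    deform u p * deform v q = deform v q * deform u p := by
  simp only [deform, mul_add, add_mul, one_mul, mul_one, smul_mul_assoc, mul_smul_comm, h]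
  module

/-- A form of the Yang–Baxter equation. -/
lemma deform_yangBaxter {u v : R} (hu : u * u = u) (hv : v * v = v) (huvu : u * v * u = 0)
    (hvuv : v * u * v = 0) {x y : ℝ} (hx : x ≠ 0) (hy : y ≠ 0) :
    deform u y⁻¹ * (deform v x * (deform u y * deform v y)) =
      deform u x⁻¹ * (deform v y * (deform u x * deform v x)) := by
  rw [mul_assoc] at huvu hvuv
  have h1 : ∀ w, u * (u * w) = u * w := fun w => by rw [← mul_assoc, hu]
  simp only [deform, mul_add, add_mul, one_mul, mul_one, smul_mul_assoc, mul_smul_comm, hu, hv,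
    huvu, hvuv, h1, smul_zero, add_zero, smul_add]
  match_scalars <;> field_simp <;> ring

/-- A form of the reflection equation. -/
lemma deform_reflection {u v : R} (hu : u * u = u) (hv : v * v = v)
    (huvu : u * v * u = 0) {x y : ℝ} (hx : x ≠ 0) (hy : y ≠ 0) :
    deform u y⁻¹ * (deform v x * (deform u (x * y) * (deform v y * deform u x⁻¹))) =
      deform u x⁻¹ * (deform v y * (deform u (y * x) * (deform v x * deform u y⁻¹))) := by
  rw [mul_assoc] at huvu
  have h1 : ∀ w, u * (u * w) = u * w := fun w => by rw [← mul_assoc, hu]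
  have h2 : ∀ w, v * (v * w) = v * w := fun w => by rw [← mul_assoc, hv]
  have h3 : ∀ w, u * (v * (u * w)) = 0 := fun w => by
    rw [← mul_assoc v, ← mul_assoc u, huvu, zero_mul]
  simp only [deform, mul_add, add_mul, one_mul, mul_one, smul_mul_assoc, mul_smul_comm, hu, hv,
    huvu, h1, h2, h3, smul_zero, add_zero, smul_add]
  match_scalars <;> field_simp <;> ring

/-- The product `deform (u 0) q * ⋯ * deform (u (n - 1)) q`. -/
def ascProd (u : ℕ → R) (n : ℕ) (q : ℝ) : R := ((List.range n).map fun i => deform (u i) q).prod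

/-- The product `deform (u (n - 1)) q * ⋯ * deform (u 0) q`. -/
def descProd (u : ℕ → R) (n : ℕ) (q : ℝ) : R :=
  ((List.range n).reverse.map fun i => deform (u i) q).prod

lemma ascProd_zero (u : ℕ → R) (q : ℝ) : ascProd u 0 q = 1 := by simp [ascProd]

lemma descProd_zero (u : ℕ → R) (q : ℝ) : descProd u 0 q = 1 := by simp [descProd]

lemma ascProd_succ (u : ℕ → R) (n : ℕ) (q : ℝ) :
    ascProd u (n + 1) q = ascProd u n q * deform (u n) q := by
  simp [ascProd, List.range_succ]

lemma descProd_succ (u : ℕ → R) (n : ℕ) (q : ℝ) :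
    descProd u (n + 1) q = deform (u n) q * descProd u n q := by
  simp [descProd, List.range_succ]

lemma ascProd_succ' (u : ℕ → R) (n : ℕ) (q : ℝ) :
    ascProd u (n + 1) q = deform (u 0) q * ascProd (fun i => u (i + 1)) n q := by
  simp [ascProd, List.range_succ_eq_map, Function.comp_def]

lemma descProd_succ' (u : ℕ → R) (n : ℕ) (q : ℝ) :
    descProd u (n + 1) q = descProd (fun i => u (i + 1)) n q * deform (u 0) q := by
  simp [descProd, List.range_succ_eq_map, Function.comp_def]

lemma ascProd_mul_deform_comm {u : ℕ → R} {v : R} {n : ℕ} (h : ∀ i < n, u i * v = v * u i)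
    (p q : ℝ) : ascProd u n p * deform v q = deform v q * ascProd u n p := by
  induction n with
  | zero => simp [ascProd_zero]
  | succ n ih =>
    rw [ascProd_succ, mul_assoc, deform_comm (h n (by omega)), ← mul_assoc,
      ih fun i hi => h i (by omega), mul_assoc]

lemma descProd_mul_deform_comm {u : ℕ → R} {v : R} {n : ℕ} (h : ∀ i < n, u i * v = v * u i)
    (p q : ℝ) : descProd u n p * deform v q = deform v q * descProd u n p := by
  induction n with
  | zero => simp [descProd_zero]
  | succ n ih =>
    rw [descProd_succ, mul_assoc, ih fun i hi => h i (by omega), ← mul_assoc,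
      deform_comm (h n (by omega)), mul_assoc]

lemma ascProd_mul_descProd_inv {u : ℕ → R} (hu : ∀ i, u i * u i = u i) {q : ℝ} (hq : q ≠ 0)
    (n : ℕ) : ascProd u n q * descProd u n q⁻¹ = 1 := by
  induction n with
  | zero => simp [ascProd_zero, descProd_zero]
  | succ n ih =>
    rw [ascProd_succ, descProd_succ, mul_assoc, ← mul_assoc (deform _ q), deform_mul_inv (hu n) hq,
      one_mul, ih]

lemma descProd_inv_mul_ascProd {u : ℕ → R} (hu : ∀ i, u i * u i = u i) {q : ℝ} (hq : q ≠ 0)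
    (n : ℕ) : descProd u n q⁻¹ * ascProd u n q = 1 := by
  induction n generalizing u with
  | zero => simp [ascProd_zero, descProd_zero]
  | succ n ih =>
    rw [ascProd_succ', descProd_succ', mul_assoc, ← mul_assoc (deform _ q⁻¹),
      deform_inv_mul (hu 0) hq, one_mul, ih fun i => hu (i + 1)]

lemma ascProd_comm {u : ℕ → R} (hu : ∀ i, u i * u i = u i)
    (hfar : ∀ i j, i + 2 ≤ j → u i * u j = u j * u i) (hnear : ∀ i, u i * u (i + 1) * u i = 0)
    (hnear' : ∀ i, u (i + 1) * u i * u (i + 1) = 0) {x y : ℝ} (hx : x ≠ 0) (hy : y ≠ 0) (n : ℕ) :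
    ascProd u n x * ascProd u n y = ascProd u n y * ascProd u n x := by
  induction n using Nat.twoStepInduction with
  | zero => simp [ascProd_zero]
  | one => simp [ascProd_succ, ascProd_zero, deform_mul (hu 0), mul_comm]
  | more n _ ih =>
    have key : ∀ p q : ℝ, q ≠ 0 → ascProd u (n + 2) p * ascProd u (n + 2) q =
        ascProd u (n + 1) p * ascProd u (n + 1) q * (deform (u n) q⁻¹ *
          (deform (u (n + 1)) p * (deform (u n) q * deform (u (n + 1)) q))) := by
      intro p q hq
      have h1 : ascProd u n q * deform (u (n + 1)) p = deform (u (n + 1)) p * ascProd u n q :=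
        ascProd_mul_deform_comm (fun i hi => hfar i (n + 1) (by omega)) _ _
      rw [ascProd_succ u (n + 1), ascProd_succ u (n + 1) q, ascProd_succ u n q]
      simp only [mul_assoc]
      rw [← mul_assoc (deform (u n) q) (deform (u n) q⁻¹), deform_mul_inv (hu n) hq, one_mul,
        ← mul_assoc (deform (u (n + 1)) p) (ascProd u n q), ← h1]
      simp only [mul_assoc]
    rw [key x y hy, key y x hx, ih,
      deform_yangBaxter (hu n) (hu (n + 1)) (hnear n) (hnear' n) hx hy]

/-- The product `deform (u n) q * ⋯ * deform (u 1) q * deform (u 0) q * deform (u 1) q * ⋯`. -/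
def wallProd (u : ℕ → R) (n : ℕ) (q : ℝ) : R :=
  descProd (fun i => u (i + 1)) n q * (deform (u 0) q * ascProd (fun i => u (i + 1)) n q)

lemma wallProd_inv_mul {u : ℕ → R} (hu : ∀ i, u i * u i = u i) {q : ℝ} (hq : q ≠ 0) (n : ℕ) :
    wallProd u n q⁻¹ * wallProd u n q = 1 := by
  have h1 := ascProd_mul_descProd_inv (fun i => hu (i + 1)) (inv_ne_zero hq) n
  have h2 := descProd_inv_mul_ascProd (fun i => hu (i + 1)) hq n
  rw [inv_inv] at h1
  simp only [wallProd, mul_assoc]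
  rw [← mul_assoc (ascProd _ n q⁻¹), h1, one_mul, ← mul_assoc (deform _ q⁻¹),
    deform_inv_mul (hu 0) hq, one_mul, h2]

lemma wallProd_comm {u : ℕ → R} (hu : ∀ i, u i * u i = u i)
    (hfar : ∀ i j, i + 2 ≤ j → u i * u j = u j * u i)
    (hnear : ∀ i, u (i + 1) * u (i + 2) * u (i + 1) = 0)
    (hnear' : ∀ i, u (i + 1) * u i * u (i + 1) = 0) {x y : ℝ} (hx : x ≠ 0) (hy : y ≠ 0) (n : ℕ) :
    wallProd u n x * wallProd u n y = wallProd u n y * wallProd u n x := by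
  set v : ℕ → R := fun i => u (i + 1) with hv
  have hv1 : ∀ i, v i * v i = v i := fun i => hu (i + 1)
  have hasc : ∀ {p q : ℝ}, p ≠ 0 → q ≠ 0 →
      ascProd v n p * ascProd v n q = ascProd v n q * ascProd v n p := fun hp hq =>
    ascProd_comm hv1 (fun i j hij => hfar _ _ (by omega)) hnear (fun i => hnear' (i + 1)) hp hq n
  have hinv : ∀ {p : ℝ}, p ≠ 0 → ascProd v n p⁻¹ * descProd v n p = 1 := fun {p} hp => by
    simpa using ascProd_mul_descProd_inv hv1 (inv_ne_zero hp) n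
  have hinv' : ∀ {p : ℝ}, p ≠ 0 → descProd v n p * ascProd v n p⁻¹ = 1 := fun {p} hp => by
    simpa using descProd_inv_mul_ascProd hv1 (inv_ne_zero hp) n
  have hda : ∀ {p q : ℝ}, p ≠ 0 → q ≠ 0 →
      ascProd v n p * descProd v n q = descProd v n q * ascProd v n p := fun {p q} hp hq => by
    calc ascProd v n p * descProd v n q
        = descProd v n q * (ascProd v n q⁻¹ * ascProd v n p) * descProd v n q := by
          rw [← mul_assoc, hinv' hq, one_mul]
      _ = descProd v n q * ascProd v n p := by
          rw [hasc (inv_ne_zero hq) hp, mul_assoc, mul_assoc, hinv hq, mul_one]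
  have hdd : descProd v n x * descProd v n y = descProd v n y * descProd v n x := by
    calc descProd v n x * descProd v n y
        = descProd v n y * (ascProd v n y⁻¹ * descProd v n x) * descProd v n y := by
          rw [← mul_assoc, hinv' hy, one_mul]
      _ = descProd v n y * descProd v n x := by
          rw [hda (inv_ne_zero hy) hx, mul_assoc, mul_assoc, hinv hy, mul_one]
  rcases n with _ | n
  · simp [wallProd, ascProd_zero, descProd_zero, deform_mul (hu 0), mul_comm]
  have key : ∀ {p q : ℝ}, p ≠ 0 → q ≠ 0 → wallProd u (n + 1) p * wallProd u (n + 1) q =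
      descProd v (n + 1) p * descProd v (n + 1) q * (deform (u 1) q⁻¹ * (deform (u 0) p *
        (deform (u 1) (p * q) * (deform (u 0) q * deform (u 1) p⁻¹)))) *
        (ascProd v (n + 1) p * ascProd v (n + 1) q) := by
    intro p q hp hq
    set a : ℝ → R := ascProd (fun i => v (i + 1)) n
    set d : ℝ → R := descProd (fun i => v (i + 1)) n
    have ha : a p * deform (u 0) q = deform (u 0) q * a p :=
      ascProd_mul_deform_comm (fun i _ => (hfar 0 (i + 2) (by omega)).symm) _ _
    have hd : d q * deform (u 0) p = deform (u 0) p * d q :=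
      descProd_mul_deform_comm (fun i _ => (hfar 0 (i + 2) (by omega)).symm) _ _
    have ea : deform (u 1) p⁻¹ * ascProd v (n + 1) p = a p := by
      rw [ascProd_succ', ← mul_assoc, deform_inv_mul (hu 1) hp, one_mul]
    have ed : descProd v (n + 1) q * deform (u 1) q⁻¹ = d q := by
      rw [descProd_succ', mul_assoc, deform_mul_inv (hu 1) hq, mul_one]
    calc wallProd u (n + 1) p * wallProd u (n + 1) q
        = descProd v (n + 1) p * deform (u 0) p * (ascProd v (n + 1) p * descProd v (n + 1) q) *
            deform (u 0) q * ascProd v (n + 1) q := by simp only [wallProd, mul_assoc, hv]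
      _ = descProd v (n + 1) p * deform (u 0) p * (d q * deform (u 1) q * (deform (u 1) p * a p)) *
            deform (u 0) q * ascProd v (n + 1) q := by
          rw [hda hp hq, descProd_succ' v n q, ascProd_succ' v n p]
      _ = descProd v (n + 1) p * (deform (u 0) p * d q) * (deform (u 1) p * deform (u 1) q) *
            (a p * deform (u 0) q) * ascProd v (n + 1) q := by
          rw [deform_mul (hu 1), mul_comm p q, ← deform_mul (hu 1)]
          simp only [mul_assoc]
      _ = _ := by
          rw [← hd, ha, deform_mul (hu 1), ← ea, ← ed]
          simp only [mul_assoc]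
  rw [key hx hy, key hy hx, hdd, hasc hx hy,
    deform_reflection (hu 1) (hu 0) (by simpa using hnear' 0) hx hy]

end HeckeProducts


/-- The height function `h` has a local maximum at `c`. -/
def IsPeak {ι : Type*} (G : SimpleGraph ι) (h : ι → ℤ) (c : ι) : Prop :=
  ∀ c', G.Adj c c' → h c' = h c - 1

/-- The height function `h` has a local minimum at `c`. -/
def IsValley {ι : Type*} (G : SimpleGraph ι) (h : ι → ℤ) (c : ι) : Prop :=
  ∀ c', G.Adj c c' → h c' = h c + 1

section Operators

variable {ι : Type*} [DecidableEq ι] {G : SimpleGraph ι}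

lemma IsValley.isPeak_update {h : ι → ℤ} {c : ι} (hv : IsValley G h c) :
    IsPeak G (update h c (h c + 2)) c := by
  intro c' hc
  have := hv c' hc
  rw [update_of_ne hc.ne', update_self]
  omega

lemma IsPeak.isValley_update {h : ι → ℤ} {c : ι} (hv : IsPeak G h c) :
    IsValley G (update h c (h c - 2)) c := by
  intro c' hc
  have := hv c' hc
  rw [update_of_ne hc.ne', update_self]
  omega

omit [DecidableEq ι] in
lemma IsPeak.not_isValley {h : ι → ℤ} {c c' : ι} (hv : IsPeak G h c) (hc : G.Adj c c') :
    ¬ IsValley G h c := fun h' => by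
  have h1 := hv c' hc
  have h2 := h' c' hc
  omega

lemma isPeak_update_iff {h : ι → ℤ} {c d : ι} (hne : c ≠ d) (hadj : ¬ G.Adj c d) (x : ℤ) :
    IsPeak G (update h c x) d ↔ IsPeak G h d := by
  refine forall_congr' fun c' => imp_congr_right fun hc => ?_
  have : c' ≠ c := by rintro rfl; exact hadj hc.symm
  rw [update_of_ne this, update_of_ne hne.symm]

lemma isValley_update_iff {h : ι → ℤ} {c d : ι} (hne : c ≠ d) (hadj : ¬ G.Adj c d) (x : ℤ) :
    IsValley G (update h c x) d ↔ IsValley G h d := by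
  refine forall_congr' fun c' => imp_congr_right fun hc => ?_
  have : c' ≠ c := by rintro rfl; exact hadj hc.symm
  rw [update_of_ne this, update_of_ne hne.symm]

variable (G) in
open Classical in
/-- The operator on functions of heights dual to turning a valley at `c` into a peak: it fixes
heights with a peak at `c` and kills heights with neither a peak nor a valley at `c`. -/
noncomputable def peakOp (c : ι) : Module.End ℝ ((ι → ℤ) → ℝ) where
  toFun φ h := if IsPeak G h c then φ h else if IsValley G h c then φ (update h c (h c + 2)) else 0
  map_add' φ ψ := by
    ext h
    simp only [Pi.add_apply]
    split_ifs <;> simp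
  map_smul' a φ := by
    ext h
    simp only [Pi.smul_apply, RingHom.id_apply]
    split_ifs <;> simp

lemma peakOp_of_isPeak {h : ι → ℤ} {c : ι} (hp : IsPeak G h c) (φ : (ι → ℤ) → ℝ) :
    peakOp G c φ h = φ h := by
  simp [peakOp, hp]

lemma peakOp_of_isValley {h : ι → ℤ} {c c' : ι} (hc : G.Adj c c') (hp : IsValley G h c)
    (φ : (ι → ℤ) → ℝ) : peakOp G c φ h = φ (update h c (h c + 2)) := by
  have : ¬ IsPeak G h c := fun h' => h'.not_isValley hc hp
  simp [peakOp, hp, this]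

lemma peakOp_of_not {h : ι → ℤ} {c : ι} (hp : ¬ IsPeak G h c) (hv : ¬ IsValley G h c)
    (φ : (ι → ℤ) → ℝ) : peakOp G c φ h = 0 := by
  simp [peakOp, hp, hv]

lemma peakOp_mul_self {c c' : ι} (hc : G.Adj c c') : peakOp G c * peakOp G c = peakOp G c := by
  refine LinearMap.ext fun φ => funext fun h => ?_
  rw [Module.End.mul_apply]
  by_cases hp : IsPeak G h c
  · rw [peakOp_of_isPeak hp]
  by_cases hv : IsValley G h c
  · rw [peakOp_of_isValley hc hv, peakOp_of_isPeak hv.isPeak_update, peakOp_of_isValley hc hv]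
  · rw [peakOp_of_not hp hv, peakOp_of_not hp hv]

lemma peakOp_comm {c d : ι} (hne : c ≠ d) (hadj : ¬ G.Adj c d) :
    peakOp G c * peakOp G d = peakOp G d * peakOp G c := by
  classical
  have hadj' : ¬ G.Adj d c := fun h => hadj h.symm
  refine LinearMap.ext fun φ => funext fun h => ?_
  have e1 : ∀ ψ, peakOp G c ψ h = if IsPeak G h c then ψ h else
      if IsValley G h c then ψ (update h c (h c + 2)) else 0 := fun ψ => by simp [peakOp]
  have e2 : ∀ ψ, peakOp G d ψ h = if IsPeak G h d then ψ h else
      if IsValley G h d then ψ (update h d (h d + 2)) else 0 := fun ψ => by simp [peakOp]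
  have e3 : ∀ ψ x, peakOp G d ψ (update h c x) = if IsPeak G h d then ψ (update h c x) else
      if IsValley G h d then ψ (update (update h c x) d (h d + 2)) else 0 := fun ψ x => by
    rw [← isPeak_update_iff hne hadj x, ← isValley_update_iff hne hadj x,
      ← update_of_ne hne.symm x h]
    simp [peakOp]
  have e4 : ∀ ψ x, peakOp G c ψ (update h d x) = if IsPeak G h c then ψ (update h d x) else
      if IsValley G h c then ψ (update (update h d x) c (h c + 2)) else 0 := fun ψ x => by
    rw [← isPeak_update_iff hne.symm hadj' x, ← isValley_update_iff hne.symm hadj' x,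
      ← update_of_ne hne x h]
    simp [peakOp]
  simp only [Module.End.mul_apply, e1, e2, e3, e4, update_comm hne]
  split_ifs <;> rfl

lemma peakOp_mul_mul_eq_zero {c d e : ι} (hcd : G.Adj c d) (hce : G.Adj c e) (hde : d ≠ e) :
    peakOp G c * peakOp G d * peakOp G c = 0 := by
  have key : ∀ h : ι → ℤ, IsPeak G h c → ∀ φ, peakOp G d (peakOp G c φ) h = 0 := by
    intro h hp φ
    have h1 := hp d hcd
    have h2 := hp e hce
    have hnp : ¬ IsPeak G h d := fun h' => by have := h' c hcd.symm; omega
    by_cases hv : IsValley G h d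
    · rw [peakOp_of_isValley hcd.symm hv, peakOp_of_not]
      · intro h'
        have := h' d hcd
        rw [update_self, update_of_ne hcd.ne] at this
        omega
      · intro h'
        have := h' e hce
        rw [update_of_ne hde.symm, update_of_ne hcd.ne] at this
        omega
    · exact peakOp_of_not hnp hv _
  refine LinearMap.ext fun φ => funext fun h => ?_
  rw [Module.End.mul_apply, Module.End.mul_apply, LinearMap.zero_apply, Pi.zero_apply]
  by_cases hp : IsPeak G h c
  · rw [peakOp_of_isPeak hp, key h hp]
  by_cases hv : IsValley G h c
  · rw [peakOp_of_isValley hcd hv, key _ hv.isPeak_update]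
  · rw [peakOp_of_not hp hv]

/-- The indicator function of a single height function. -/
noncomputable def heightIndicator (η : ι → ℤ) : (ι → ℤ) → ℝ := Set.indicator {η} 1

omit [DecidableEq ι] in
lemma heightIndicator_self (η : ι → ℤ) : heightIndicator η η = 1 := by simp [heightIndicator]

omit [DecidableEq ι] in
lemma heightIndicator_of_ne {η h : ι → ℤ} (hne : h ≠ η) : heightIndicator η h = 0 := by
  simp [heightIndicator, hne]

lemma peakOp_heightIndicator_of_isPeak {η : ι → ℤ} {c c' : ι} (hc : G.Adj c c') (hp : IsPeak G η c) :
    peakOp G c (heightIndicator η) = heightIndicator η + heightIndicator (update η c (η c - 2)) := by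
  have hne : η ≠ update η c (η c - 2) := fun h' => by
    have := congrFun h' c
    rw [update_self] at this
    omega
  funext h
  rw [Pi.add_apply]
  by_cases hp' : IsPeak G h c
  · have : h ≠ update η c (η c - 2) := fun h' => (h' ▸ hp').not_isValley hc hp.isValley_update
    rw [peakOp_of_isPeak hp', heightIndicator_of_ne this, add_zero]
  have hη : h ≠ η := fun h' => hp' (h' ▸ hp)
  rw [heightIndicator_of_ne hη, zero_add]
  by_cases hv : IsValley G h c
  · rw [peakOp_of_isValley hc hv]
    by_cases h1 : h = update η c (η c - 2)
    · subst h1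
      simp [heightIndicator_self]
    · rw [heightIndicator_of_ne h1, heightIndicator_of_ne]
      rintro rfl
      simp at h1
  · rw [peakOp_of_not hp' hv, heightIndicator_of_ne]
    rintro rfl
    exact hv hp.isValley_update

/-- `φ` is supported on heights agreeing with `η` off the sites of `s`. -/
def AgreeOff (s : Set ι) (η : ι → ℤ) (φ : (ι → ℤ) → ℝ) : Prop :=
  ∀ h, φ h ≠ 0 → ∀ c ∉ s, h c = η c

omit [DecidableEq ι] in
lemma agreeOff_heightIndicator (η : ι → ℤ) (s : Set ι) : AgreeOff s η (heightIndicator η) := by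
  intro h hh c _
  by_contra hne
  exact hh (heightIndicator_of_ne fun h' => hne (by rw [h']))

lemma AgreeOff.peakOp_eq_zero {s : Set ι} {η : ι → ℤ} {φ : (ι → ℤ) → ℝ} (hφ : AgreeOff s η φ)
    {c d : ι} (hcd : G.Adj c d) (hc : c ∉ s) (hd : d ∉ s) (hη : η d ≠ η c - 1) :
    peakOp G c φ = 0 := by
  have key : ∀ h, IsPeak G h c → φ h = 0 := by
    intro h hp
    by_contra hne
    have h1 := hφ h hne c hc
    have h2 := hφ h hne d hd
    have h3 := hp d hcd
    omega
  funext h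
  by_cases hp : IsPeak G h c
  · rw [peakOp_of_isPeak hp, key h hp]; rfl
  by_cases hv : IsValley G h c
  · rw [peakOp_of_isValley hcd hv, key _ hv.isPeak_update]; rfl
  · rw [peakOp_of_not hp hv]; rfl

variable (G) in
/-- The one-parameter family `1 + (q - 1) U` with `U` the idempotent `peakOp G c`. -/
noncomputable def hop (c : ι) (q : ℝ) : Module.End ℝ ((ι → ℤ) → ℝ) :=
  deform (peakOp G c) q

lemma hop_apply (c : ι) (q : ℝ) (φ : (ι → ℤ) → ℝ) :
    hop G c q φ = φ + (q - 1) • peakOp G c φ := by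
  simp [hop, deform]

lemma AgreeOff.hop_eq_self {s : Set ι} {η : ι → ℤ} {φ : (ι → ℤ) → ℝ} (hφ : AgreeOff s η φ)
    {c d : ι} (hcd : G.Adj c d) (hc : c ∉ s) (hd : d ∉ s) (hη : η d ≠ η c - 1) (q : ℝ) :
    hop G c q φ = φ := by
  rw [hop_apply, hφ.peakOp_eq_zero hcd hc hd hη, smul_zero, add_zero]

/-- If `φ` vanishes on a set of heights stable under raising `c`, so does `hop G c q φ`. -/
lemma hop_apply_eq_zero {P Q : (ι → ℤ) → Prop} {φ : (ι → ℤ) → ℝ} (hφ : ∀ h, P h → φ h = 0)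
    (hQP : ∀ h, Q h → P h) (c : ι)
    (hup : ∀ h, Q h → ¬ IsPeak G h c → IsValley G h c → P (update h c (h c + 2)))
    (q : ℝ) : ∀ h, Q h → hop G c q φ h = 0 := by
  intro h hh
  have : peakOp G c φ h = 0 := by
    by_cases hp : IsPeak G h c
    · rw [peakOp_of_isPeak hp, hφ h (hQP h hh)]
    by_cases hv : IsValley G h c
    · simp [peakOp, hp, hv, hφ _ (hup h hh hp hv)]
    · exact peakOp_of_not hp hv _
  rw [hop_apply, Pi.add_apply, Pi.smul_apply, this, hφ h (hQP h hh)]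
  simp

lemma AgreeOff.hop {s : Set ι} {η : ι → ℤ} {φ : (ι → ℤ) → ℝ} (hφ : AgreeOff s η φ) (c : ι)
    (q : ℝ) : AgreeOff (insert c s) η (hop G c q φ) := by
  intro h hh d hd
  by_contra hne
  have hd' : d ≠ c ∧ d ∉ s := by simpa using hd
  refine hh (hop_apply_eq_zero (P := fun h => h d ≠ η d) (Q := fun h => h d ≠ η d)
    (fun h hP => ?_) (fun _ => id) c (fun h hQ _ _ => ?_) q h hne)
  · by_contra h0
    exact hP (hφ h h0 d hd'.2)
  · rwa [update_of_ne hd'.1]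

lemma hop_zero_heightIndicator {η : ι → ℤ} {c c' : ι} (hc : G.Adj c c') (hp : IsPeak G η c) :
    _root_.hop G c 0 (heightIndicator η) = -heightIndicator (update η c (η c - 2)) := by
  rw [hop_apply, peakOp_heightIndicator_of_isPeak hc hp]
  simp

lemma continuous_hop {c : ι} {q : ℝ → ℝ} (hq : Continuous q) {φ : ℝ → (ι → ℤ) → ℝ}
    (hφ : ∀ h, Continuous fun t => φ t h) (h : ι → ℤ) :
    Continuous fun t => _root_.hop G c (q t) (φ t) h := by
  simp only [hop_apply, Pi.add_apply, Pi.smul_apply, smul_eq_mul]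
  refine (hφ h).add ((hq.sub continuous_const).mul ?_)
  simp only [peakOp, LinearMap.coe_mk, AddHom.coe_mk]
  split_ifs
  · exact hφ _
  · exact hφ _
  · exact continuous_const

end Operators

section Uniqueness

/-- Properties of the generating function `F m L` of heights of size `m ≤ N` reached by applying
transfer operators with parameters in the list `L`; they determine `F m L` on generic lists. -/
structure IsTransferFamily (N : ℕ) (F : ℕ → List ℝ → ℝ) : Prop where
  cons_perm {m : ℕ} (hm : m ≤ N) (y : ℝ) {L L' : List ℝ} (hL : L.Perm L') (h0 : ∀ x ∈ L, x ≠ 0) :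
    F m (y :: L) = F m (y :: L')
  exists_poly {m : ℕ} (hm : m ≤ N) (L : List ℝ) :
    ∃ p : Polynomial ℝ, p.natDegree ≤ m ∧ ∀ y, F m (y :: L) = p.eval y
  one_cons (m : ℕ) (L : List ℝ) : F m (1 :: L) = F m L
  inv_cons_cons {m : ℕ} (hm : m ≤ N) {q : ℝ} (hq : 0 < q) (L : List ℝ) :
    F m (q⁻¹ :: q :: L) = F m L
  zero_cons {m : ℕ} (hm : m + 1 ≤ N) (L : List ℝ) : F (m + 1) (0 :: L) = (-1) ^ (m + 1) * F m L
  zero_left (L : List ℝ) : F 0 L = 1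
  eq_zero_of_length_lt {m : ℕ} (hm : m ≤ N) {L : List ℝ} (hL : L.length < m) : F m L = 0

lemma IsTransferFamily.eq_of_nodup {N : ℕ} {F F' : ℕ → List ℝ → ℝ} (hF : IsTransferFamily N F)
    (hF' : IsTransferFamily N F') {m : ℕ} (hm : m ≤ N) {L : List ℝ} (hL : L.Nodup)
    (h1 : ∀ x ∈ L, 1 < x) : F m L = F' m L := by
  induction hlen : L.length using Nat.strong_induction_on generalizing m L with
  | _ l ih =>
    rcases m with _ | m
    · rw [hF.zero_left, hF'.zero_left]
    rcases lt_or_ge L.length (m + 1) with hlt | hge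
    · rw [hF.eq_zero_of_length_lt hm hlt, hF'.eq_zero_of_length_lt hm hlt]
    rcases L with _ | ⟨q, L⟩
    · simp at hge
    rw [List.length_cons] at hlen hge
    have hL' := (List.nodup_cons.1 hL).2
    have h1' : ∀ x ∈ L, 1 < x := fun x hx => h1 x (List.mem_cons_of_mem _ hx)
    obtain ⟨p, hpdeg, hp⟩ := hF.exists_poly hm L
    obtain ⟨p', hpdeg', hp'⟩ := hF'.exists_poly hm L
    let s : Finset ℝ := insert 0 (insert 1 (L.toFinset.image fun r => r⁻¹))
    have hcard : s.card = L.length + 2 := by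
      have h01 : (1 : ℝ) ∉ L.toFinset.image fun r => r⁻¹ := by
        simp only [Finset.mem_image, List.mem_toFinset, not_exists, not_and]
        exact fun x hx h => (h1' x hx).ne' (by simpa using h)
      have h00 : (0 : ℝ) ∉ insert 1 (L.toFinset.image fun r => r⁻¹) := by
        simp only [Finset.mem_insert, zero_ne_one, false_or, Finset.mem_image, List.mem_toFinset,
          not_exists, not_and]
        exact fun x hx h => (zero_lt_one.trans (h1' x hx)).ne' (by simpa using h)
      rw [Finset.card_insert_of_notMem h00, Finset.card_insert_of_notMem h01,
        Finset.card_image_of_injective _ inv_injective, List.toFinset_card_of_nodup hL']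
    have heq : p = p' := by
      refine Polynomial.eq_of_natDegree_lt_card_of_eval_eq' p p' s (fun x hx => ?_) (by omega)
      rw [← hp, ← hp']
      simp only [s, Finset.mem_insert, Finset.mem_image, List.mem_toFinset] at hx
      rcases hx with rfl | rfl | ⟨r, hr, rfl⟩
      · rw [hF.zero_cons hm, hF'.zero_cons hm, ih L.length (by omega) (by omega) hL' h1' rfl]
      · rw [hF.one_cons, hF'.one_cons, ih L.length (by omega) hm hL' h1' rfl]
      · have hperm := List.perm_cons_erase hr
        have h0 : ∀ x ∈ L, x ≠ 0 := fun x hx => (zero_lt_one.trans (h1' x hx)).ne'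
        have hr0 : 0 < r := zero_lt_one.trans (h1' r hr)
        rw [hF.cons_perm hm _ hperm h0, hF'.cons_perm hm _ hperm h0, hF.inv_cons_cons hm hr0,
          hF'.inv_cons_cons hm hr0]
        have hle := List.length_erase_of_mem hr
        exact ih _ (by omega) hm (hL'.erase r) (fun x hx => h1' x (List.mem_of_mem_erase hx)) rfl
    rw [hp, hp', heq]

lemma IsTransferFamily.eq_replicate {N : ℕ} {F F' : ℕ → List ℝ → ℝ} (hF : IsTransferFamily N F)
    (hF' : IsTransferFamily N F') {m : ℕ} (hm : m ≤ N)
    (hc : ∀ f : List (ℝ → ℝ), (∀ a ∈ f, Continuous a) → Continuous fun t => F m (f.map (· t)))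
    (hc' : ∀ f : List (ℝ → ℝ), (∀ a ∈ f, Continuous a) → Continuous fun t => F' m (f.map (· t)))
    (n : ℕ) : F m (List.replicate n 2) = F' m (List.replicate n 2) := by
  let f : List (ℝ → ℝ) := (List.range n).map fun (i : ℕ) t => 2 + i * t
  have hf : ∀ a ∈ f, Continuous a := by
    simp only [f, List.mem_map, forall_exists_index, and_imp]
    rintro _ i _ rfl
    fun_prop
  have hev : ∀ t, f.map (· t) = (List.range n).map fun i : ℕ => 2 + (i : ℝ) * t := fun t => by
    simp [f, Function.comp_def]
  have h2 : f.map (· 0) = List.replicate n 2 := by simp [hev]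
  have hcl : IsClosed {t | F m (f.map (· t)) = F' m (f.map (· t))} := isClosed_eq (hc f hf) (hc' f hf)
  have hsub : Set.Ioi (0 : ℝ) ⊆ {t | F m (f.map (· t)) = F' m (f.map (· t))} := by
    intro t ht
    rw [Set.mem_Ioi] at ht
    refine hF.eq_of_nodup hF' hm ?_ ?_
    · rw [hev]
      refine List.nodup_range.map fun i j hij => ?_
      simpa [ht.ne'] using hij
    · rw [hev]
      simp only [List.mem_map, forall_exists_index, and_imp]
      rintro _ i _ rfl
      nlinarith [mul_nonneg (Nat.cast_nonneg (α := ℝ) i) ht.le]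
  have h0 : (0 : ℝ) ∈ closure (Set.Ioi (0 : ℝ)) := by simp
  have := hcl.closure_subset_iff.2 hsub h0
  simpa only [Set.mem_ofPred_eq, h2] using this

end Uniqueness

section HopProducts

variable {ι : Type*} [DecidableEq ι] {G : SimpleGraph ι}

variable (G) in
/-- The product of the operators `hop G c q` over a list of sites `c`. -/
noncomputable def hopProd (cs : List ι) (q : ℝ) : Module.End ℝ ((ι → ℤ) → ℝ) :=
  (cs.map fun c => hop G c q).prod

lemma hopProd_nil (q : ℝ) : hopProd G [] q = 1 := rfl

lemma hopProd_cons (c : ι) (cs : List ι) (q : ℝ) :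
    hopProd G (c :: cs) q = hop G c q * hopProd G cs q := by
  simp [hopProd]

lemma hopProd_append (cs ds : List ι) (q : ℝ) :
    hopProd G (cs ++ ds) q = hopProd G cs q * hopProd G ds q := by
  simp [hopProd]

lemma hopProd_one (cs : List ι) : hopProd G cs 1 = 1 := by
  induction cs with
  | nil => rfl
  | cons c cs ih => rw [hopProd_cons, ih, hop, deform_one, one_mul]

lemma hop_comm {c d : ι} (hadj : ¬ G.Adj c d) (q : ℝ) : Commute (hop G c q) (hop G d q) := by
  rcases eq_or_ne c d with rfl | hne
  · exact Commute.refl _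
  · exact deform_comm (peakOp_comm hne hadj) q q

lemma hopProd_perm {cs ds : List ι} (h : cs.Perm ds) (hadj : cs.Pairwise fun c d => ¬ G.Adj c d)
    (q : ℝ) : hopProd G cs q = hopProd G ds q := by
  refine (h.map _).prod_eq' (List.pairwise_map.2 (hadj.imp fun hcd => hop_comm hcd q))

lemma exists_polynomial_hopProd (cs : List ι) (φ : (ι → ℤ) → ℝ) (Λ : ((ι → ℤ) → ℝ) →ₗ[ℝ] ℝ) :
    ∃ p : Polynomial ℝ, p.natDegree ≤ cs.length ∧ ∀ y, Λ (hopProd G cs y φ) = p.eval y := by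
  induction cs generalizing Λ with
  | nil => exact ⟨Polynomial.C (Λ φ), by simp, fun y => by simp [hopProd_nil]⟩
  | cons c cs ih =>
    obtain ⟨p, hp, hpe⟩ := ih Λ
    obtain ⟨p', hp', hpe'⟩ := ih (Λ ∘ₗ peakOp G c)
    refine ⟨p + (Polynomial.X - Polynomial.C 1) * p', ?_, fun y => ?_⟩
    · refine (Polynomial.natDegree_add_le _ _).trans (max_le (hp.trans (by simp)) ?_)
      refine Polynomial.natDegree_mul_le.trans ?_
      rw [Polynomial.natDegree_X_sub_C, List.length_cons]
      omega
    · rw [hopProd_cons, Module.End.mul_apply, hop_apply, map_add, map_smul, hpe]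
      have := hpe' y
      rw [LinearMap.comp_apply] at this
      simp [this]

lemma continuous_hopProd (cs : List ι) {q : ℝ → ℝ} (hq : Continuous q) {φ : ℝ → (ι → ℤ) → ℝ}
    (hφ : ∀ h, Continuous fun t => φ t h) (h : ι → ℤ) :
    Continuous fun t => hopProd G cs (q t) (φ t) h := by
  induction cs generalizing h with
  | nil => exact hφ h
  | cons c cs ih =>
    simp only [hopProd_cons, Module.End.mul_apply]
    exact continuous_hop hq ih h

lemma AgreeOff.hopProd {s : Set ι} {η : ι → ℤ} {φ : (ι → ℤ) → ℝ} (hφ : AgreeOff s η φ)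
    (cs : List ι) (q : ℝ) : AgreeOff (s ∪ {c | c ∈ cs}) η (hopProd G cs q φ) := by
  induction cs with
  | nil => simpa [hopProd_nil] using hφ
  | cons c cs ih =>
    rw [hopProd_cons, Module.End.mul_apply]
    convert ih.hop c q using 1
    ext d
    simp [or_left_comm]

/-- Sites `c` outside `P` act trivially if `nb c` is a neighbour not yet moved whose height
prevents `c` from being a peak. -/
lemma hopProd_heightIndicator_eq_filter {η : ι → ℤ} (P : ι → Prop) [DecidablePred P] (nb : ι → ι)
    {cs : List ι} (hnb : ∀ c ∈ cs, ¬ P c → G.Adj c (nb c) ∧ η (nb c) ≠ η c - 1)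
    (hcs : cs.Pairwise fun c d => ¬ P c → P d → d ≠ nb c) (q : ℝ) :
    _root_.hopProd G cs q (heightIndicator η) =
      _root_.hopProd G (cs.filter P) q (heightIndicator η) := by
  induction cs with
  | nil => rfl
  | cons c cs ih =>
    rw [List.pairwise_cons] at hcs
    have ih' := ih (fun d hd => hnb d (List.mem_cons_of_mem _ hd)) hcs.2
    rw [hopProd_cons, Module.End.mul_apply, ih']
    by_cases hc : P c
    · rw [List.filter_cons_of_pos (by simpa using hc), hopProd_cons, Module.End.mul_apply]
    · rw [List.filter_cons_of_neg (by simpa using hc)]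
      obtain ⟨h1, h2⟩ := hnb c List.mem_cons_self hc
      refine ((agreeOff_heightIndicator η ∅).hopProd (cs.filter P) q).hop_eq_self h1 ?_ ?_ h2 q
      · simp [hc]
      · simp only [List.mem_filter, decide_eq_true_eq, Set.empty_union]
        exact fun h => hcs.1 _ h.1 hc h.2 rfl

lemma hopProd_zero_heightIndicator {η : ι → ℤ} {cs : List ι} (hnd : cs.Nodup)
    (hadj : cs.Pairwise fun c d => ¬ G.Adj c d) (hpk : ∀ c ∈ cs, IsPeak G η c)
    (hnb : ∀ c ∈ cs, ∃ c', G.Adj c c') :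
    hopProd G cs 0 (heightIndicator η) =
      (-1 : ℝ) ^ cs.length • heightIndicator fun d => if d ∈ cs then η d - 2 else η d := by
  induction cs with
  | nil => simp [hopProd_nil]
  | cons c cs ih =>
    rw [List.pairwise_cons] at hadj
    rw [List.nodup_cons] at hnd
    obtain ⟨c', hc'⟩ := hnb c List.mem_cons_self
    have hc := hpk c List.mem_cons_self
    have hp : IsPeak G (fun d => if d ∈ cs then η d - 2 else η d) c := by
      intro d hd
      have : d ∉ cs := fun h => hadj.1 d h hd
      simp [this, hnd.1, hc d hd]
    rw [hopProd_cons, Module.End.mul_apply, ih hnd.2 hadj.2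
      (fun d hd => hpk d (List.mem_cons_of_mem _ hd))
      (fun d hd => hnb d (List.mem_cons_of_mem _ hd)), map_smul, hop_zero_heightIndicator hc' hp,
      List.length_cons, pow_succ, mul_neg_one, smul_neg, neg_smul]
    congr 3
    funext d
    rcases eq_or_ne d c with rfl | hd
    · simp [hnd.1]
    · simp [hd]

end HopProducts

section Transfer

variable {ι : Type*} [DecidableEq ι]

/-- Apply `A q` successively for `q` in `L`, starting with the head of `L`, to the indicator of
`η`, and evaluate at `h₀`. -/
noncomputable def transfer (A : ℝ → Module.End ℝ ((ι → ℤ) → ℝ)) (h₀ η : ι → ℤ) (L : List ℝ) : ℝ :=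
  (L.reverse.map A).prod (heightIndicator η) h₀

lemma IsTransferFamily.of_hopProd {G : SimpleGraph ι} {cs : List ι} {h₀ : ι → ℤ}
    {η : ℕ → ι → ℤ} {N : ℕ}
    (hcomm : ∀ x y : ℝ, x ≠ 0 → y ≠ 0 → Commute (hopProd G cs x) (hopProd G cs y))
    (hinv : ∀ m ≤ N, ∀ q : ℝ, 0 < q →
      hopProd G cs q⁻¹ (hopProd G cs q (heightIndicator (η m))) = heightIndicator (η m))
    (hdeg : ∀ m ≤ N, ∃ ds : List ι, ds.length ≤ m ∧
      ∀ q, hopProd G cs q (heightIndicator (η m)) = hopProd G ds q (heightIndicator (η m)))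
    (hzero : ∀ m, m + 1 ≤ N → hopProd G cs 0 (heightIndicator (η (m + 1))) =
      (-1 : ℝ) ^ (m + 1) • heightIndicator (η m))
    (hη : η 0 = h₀) (P : ℕ → (ι → ℤ) → Prop) (hP : ∀ r, 1 ≤ r → P r h₀)
    (hPη : ∀ m ≤ N, 1 ≤ m → ¬ P m (η m))
    (hPstep : ∀ (r : ℕ) (q : ℝ) (φ : (ι → ℤ) → ℝ), (∀ h, P (r + 1) h → φ h = 0) →
      ∀ h, P r h → hopProd G cs q φ h = 0) :
    IsTransferFamily N fun m => transfer (hopProd G cs) h₀ (η m) where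
  cons_perm {m} _ y L L' hL h0 := by
    simp only [transfer, List.reverse_cons, List.map_append, List.prod_append]
    have h1 : L.reverse.Perm L'.reverse := (List.reverse_perm L).trans
      (hL.trans (List.reverse_perm L').symm)
    have h2 : (L.reverse.map (hopProd G cs)).prod = (L'.reverse.map (hopProd G cs)).prod := by
      refine (h1.map _).prod_eq' (List.pairwise_map.2 ?_)
      refine List.Pairwise.imp_of_mem (R := fun _ _ => True) (fun hx hy _ => ?_)
        (List.pairwise_of_forall fun _ _ => trivial)
      exact hcomm _ _ (h0 _ (List.mem_reverse.1 hx)) (h0 _ (List.mem_reverse.1 hy))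
    rw [h2]
  exists_poly {m} hm L := by
    obtain ⟨ds, hlen, hds⟩ := hdeg m hm
    obtain ⟨p, hp, hpe⟩ := exists_polynomial_hopProd (G := G) ds (heightIndicator (η m))
      (LinearMap.proj h₀ ∘ₗ (L.reverse.map (hopProd G cs)).prod)
    refine ⟨p, hp.trans hlen, fun y => ?_⟩
    rw [← hpe, ← hds]
    simp [transfer]
  one_cons m L := by simp [transfer, hopProd_one]
  inv_cons_cons {m} hm q hq L := by
    have e : hopProd G cs q * hopProd G cs q⁻¹ = hopProd G cs q⁻¹ * hopProd G cs q :=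
      hcomm _ _ hq.ne' (inv_ne_zero hq.ne')
    simp only [transfer, List.reverse_cons, List.append_assoc, List.map_append, List.prod_append,
      List.map_cons, List.map_nil, List.prod_cons, List.prod_nil, mul_one, List.cons_append,
      List.nil_append, Module.End.mul_apply]
    rw [← Module.End.mul_apply (hopProd G cs q), e, Module.End.mul_apply, hinv m hm q hq]
  zero_cons {m} hm L := by
    simp [transfer, hzero m hm]
  zero_left L := by
    subst hη
    obtain ⟨ds, hlen, hds⟩ := hdeg 0 (Nat.zero_le _)
    obtain rfl : ds = [] := List.length_eq_zero_iff.1 (by omega)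
    have : (L.reverse.map (hopProd G cs)).prod (heightIndicator (η 0)) =
        heightIndicator (η 0) := by
      induction L with
      | nil => rfl
      | cons q L ih => simpa [hds, hopProd_nil] using ih
    rw [transfer, this, heightIndicator_self]
  eq_zero_of_length_lt {m} hm L hL := by
    have key : ∀ (L : List ℝ) (r : ℕ) (φ : (ι → ℤ) → ℝ), (∀ h, P (r + L.length) h → φ h = 0) →
        ∀ h, P r h → (L.reverse.map (hopProd G cs)).prod φ h = 0 := by
      intro L
      induction L with
      | nil => intro r φ hφ h hh; exact hφ h hh
      | cons q L ih =>
        intro r φ hφ h hh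
        have := ih r (hopProd G cs q φ) (hPstep _ q φ (by simpa [add_assoc] using hφ)) h hh
        simpa using this
    refine key L (m - L.length) _ (fun h hh => heightIndicator_of_ne ?_) h₀ (hP _ (by omega))
    rintro rfl
    rw [Nat.sub_add_cancel hL.le] at hh
    exact hPη m hm (by omega) hh

lemma continuous_transfer_hopProd (G : SimpleGraph ι) (cs : List ι) (h₀ η : ι → ℤ)
    (f : List (ℝ → ℝ)) (hf : ∀ a ∈ f, Continuous a) :
    Continuous fun t => transfer (hopProd G cs) h₀ η (f.map (· t)) := by
  have key : ∀ (f : List (ℝ → ℝ)) (φ : ℝ → (ι → ℤ) → ℝ), (∀ a ∈ f, Continuous a) →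
      (∀ h, Continuous fun t => φ t h) →
      ∀ h, Continuous fun t => ((f.map (· t)).reverse.map (hopProd G cs)).prod (φ t) h := by
    intro f
    induction f with
    | nil => intro φ _ hφ h; exact hφ h
    | cons a f ih =>
      intro φ hf hφ h
      have := ih (fun t => hopProd G cs (a t) (φ t)) (fun b hb => hf b (List.mem_cons_of_mem _ hb))
        (continuous_hopProd cs (hf a List.mem_cons_self) hφ) h
      simpa using this
  exact key f (fun _ => heightIndicator η) hf (fun _ => continuous_const) h₀

end Transfer

section LineFamily

open SimpleGraph

lemma hasse_int_adj {a b : ℤ} : (hasse ℤ).Adj a b ↔ a + 1 = b ∨ b + 1 = a := by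
  simp [hasse_adj, Order.covBy_iff_add_one_eq]

/-- The sites `-M, …, M` in increasing order. -/
def lineSites (M : ℕ) : List ℤ := (List.range (2 * M + 1)).map fun i : ℕ => (i : ℤ) - M

/-- The zigzag height function whose `m` peaks have height `m + 1`. -/
def lineHeight (m : ℕ) (c : ℤ) : ℤ :=
  if -(m : ℤ) < c ∧ c < m then m + (c + m) % 2 else max c (-c)

/-- The peaks of `lineHeight m`. -/
def linePeaks (m : ℕ) : List ℤ := (List.range m).map fun i : ℕ => 2 * (i : ℤ) - m + 1

lemma mem_linePeaks {m : ℕ} {c : ℤ} :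
    c ∈ linePeaks m ↔ -(m : ℤ) < c ∧ c < m ∧ (c + m) % 2 = 1 := by
  simp only [linePeaks, List.mem_map, List.mem_range]
  constructor
  · rintro ⟨i, hi, rfl⟩
    omega
  · rintro ⟨h1, h2, h3⟩
    exact ⟨((c + m - 1) / 2).toNat, by omega, by omega⟩

lemma mem_lineSites {M : ℕ} {c : ℤ} : c ∈ lineSites M ↔ -(M : ℤ) ≤ c ∧ c ≤ M := by
  simp only [lineSites, List.mem_map, List.mem_range]
  constructor
  · rintro ⟨i, hi, rfl⟩
    omega
  · rintro ⟨h1, h2⟩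
    exact ⟨(c + M).toNat, by omega, by omega⟩

lemma pairwise_lineSites (M : ℕ) : (lineSites M).Pairwise (· < ·) :=
  List.pairwise_map.2 (List.pairwise_lt_range.imp fun h => by omega)

lemma pairwise_linePeaks (m : ℕ) :
    (linePeaks m).Pairwise fun c d => ¬ (hasse ℤ).Adj c d := by
  refine List.pairwise_of_forall_mem_list fun c hc d hd h => ?_
  rw [mem_linePeaks] at hc hd
  rw [hasse_int_adj] at h
  omega

lemma nodup_linePeaks (m : ℕ) : (linePeaks m).Nodup :=
  List.nodup_range.map fun i j h => by simpa using h

lemma isPeak_lineHeight {m : ℕ} {c : ℤ} (hc : c ∈ linePeaks m) :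
    IsPeak (hasse ℤ) (lineHeight m) c := by
  rw [mem_linePeaks] at hc
  intro d hd
  rw [hasse_int_adj] at hd
  unfold lineHeight
  split_ifs <;> omega

lemma filter_lineSites_perm {m M : ℕ} (hm : m ≤ M) :
    ((lineSites M).filter (· ∈ linePeaks m)).Perm (linePeaks m) := by
  refine (List.perm_ext_iff_of_nodup ?_ (nodup_linePeaks m)).2 fun c => ?_
  · exact ((pairwise_lineSites M).imp fun h => h.ne).filter _
  · simp only [List.mem_filter, decide_eq_true_eq, and_iff_right_iff_imp]
    rw [mem_linePeaks, mem_lineSites]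
    omega

lemma hopProd_lineSites_heightIndicator {m M : ℕ} (hm : m ≤ M) (q : ℝ) :
    hopProd (hasse ℤ) (lineSites M) q (heightIndicator (lineHeight m)) =
      hopProd (hasse ℤ) (linePeaks m) q (heightIndicator (lineHeight m)) := by
  rw [hopProd_heightIndicator_eq_filter (· ∈ linePeaks m)
    (fun c => if (m : ℤ) ≤ c then c + 1 else c - 1), hopProd_perm (filter_lineSites_perm hm).symm
    (pairwise_linePeaks m)]
  · intro c _ hc
    rw [mem_linePeaks] at hc
    rw [hasse_int_adj]
    unfold lineHeight
    split_ifs <;> omega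
  · refine (pairwise_lineSites M).imp fun {c d} hcd _ hd => ?_
    rw [mem_linePeaks] at hd
    split_ifs <;> omega

lemma hopProd_reverse_lineSites_heightIndicator {m M : ℕ} (hm : m ≤ M) (q : ℝ) :
    hopProd (hasse ℤ) (lineSites M).reverse q (heightIndicator (lineHeight m)) =
      hopProd (hasse ℤ) (linePeaks m) q (heightIndicator (lineHeight m)) := by
  rw [hopProd_heightIndicator_eq_filter (· ∈ linePeaks m)
    (fun c => if c ≤ -(m : ℤ) then c - 1 else c + 1), List.filter_reverse,
    hopProd_perm ((List.reverse_perm _).trans (filter_lineSites_perm hm)).symm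
    (pairwise_linePeaks m)]
  · intro c _ hc
    rw [mem_linePeaks] at hc
    rw [hasse_int_adj]
    unfold lineHeight
    split_ifs <;> omega
  · refine (List.pairwise_reverse.2 (pairwise_lineSites M)).imp fun {c d} hcd _ hd => ?_
    rw [mem_linePeaks] at hd
    split_ifs <;> omega

lemma hopProd_lineSites (M : ℕ) (q : ℝ) : hopProd (hasse ℤ) (lineSites M) q =
    ascProd (fun i : ℕ => peakOp (hasse ℤ) ((i : ℤ) - M)) (2 * M + 1) q := by
  rw [hopProd, lineSites, List.map_map]
  rfl

lemma hopProd_reverse_lineSites (M : ℕ) (q : ℝ) : hopProd (hasse ℤ) (lineSites M).reverse q =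
    descProd (fun i : ℕ => peakOp (hasse ℤ) ((i : ℤ) - M)) (2 * M + 1) q := by
  rw [hopProd, lineSites, ← List.map_reverse, List.map_map]
  rfl

lemma peakOp_int_mul_self (c : ℤ) :
    peakOp (hasse ℤ) c * peakOp (hasse ℤ) c = peakOp (hasse ℤ) c :=
  peakOp_mul_self (hasse_int_adj.2 (Or.inl (rfl : c + 1 = c + 1)))

lemma commute_hopProd_lineSites (M : ℕ) {x y : ℝ} (hx : x ≠ 0) (hy : y ≠ 0) :
    Commute (hopProd (hasse ℤ) (lineSites M) x) (hopProd (hasse ℤ) (lineSites M) y) := by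
  rw [hopProd_lineSites, hopProd_lineSites]
  refine ascProd_comm (fun i => peakOp_int_mul_self _) (fun i j hij => ?_) (fun i => ?_)
    (fun i => ?_) hx hy _
  · refine peakOp_comm ?_ ?_
    · omega
    · rw [hasse_int_adj]
      omega
  · refine peakOp_mul_mul_eq_zero (e := (i : ℤ) - M - 1) ?_ ?_ ?_
    · rw [hasse_int_adj]
      omega
    · rw [hasse_int_adj]
      omega
    · omega
  · refine peakOp_mul_mul_eq_zero (e := (i : ℤ) - M + 2) ?_ ?_ ?_
    · rw [hasse_int_adj]
      omega
    · rw [hasse_int_adj]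
      omega
    · omega

/-- Sites weakly left of `-r` do not move in a height that is straight left of `1 - r`. -/
lemma hopProd_lineSites_apply_eq_zero (M r : ℕ) (q : ℝ) (φ : (ℤ → ℤ) → ℝ)
    (hφ : ∀ h, (∀ c : ℤ, c ≤ -r → h c = -c) → φ h = 0) (h : ℤ → ℤ)
    (hh : ∀ c : ℤ, c ≤ 1 - r → h c = -c) :
    hopProd (hasse ℤ) (lineSites M) q φ h = 0 := by
  have hright : ∀ cs : List ℤ, (∀ c ∈ cs, -(r : ℤ) < c) →
      ∀ h, (∀ c : ℤ, c ≤ -r → h c = -c) → hopProd (hasse ℤ) cs q φ h = 0 := by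
    intro cs hcs
    induction cs with
    | nil => exact hφ
    | cons c cs ih =>
      rw [hopProd_cons, Module.End.mul_apply]
      have hc := hcs c List.mem_cons_self
      refine hop_apply_eq_zero (ih fun d hd => hcs d (List.mem_cons_of_mem _ hd)) (fun _ => id) c
        (fun h hQ _ _ d hd => ?_) q
      rw [update_of_ne (by omega), hQ d hd]
  have hall : ∀ cs : List ℤ, cs.Pairwise (· < ·) →
      ∀ h, (∀ c : ℤ, c ≤ 1 - r → h c = -c) → hopProd (hasse ℤ) cs q φ h = 0 := by
    intro cs hcs
    induction cs with
    | nil => exact fun h hh => hφ h fun c hc => hh c (by omega)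
    | cons c cs ih =>
      rw [List.pairwise_cons] at hcs
      rcases lt_or_ge (-(r : ℤ)) c with hc | hc
      · refine fun h hh => hright _ (fun d hd => ?_) h fun c hc => hh c (by omega)
        rcases List.mem_cons.1 hd with rfl | hd
        · exact hc
        · exact hc.trans (hcs.1 d hd)
      · rw [hopProd_cons, Module.End.mul_apply]
        refine hop_apply_eq_zero (ih hcs.2) (fun _ => id) c (fun h hQ _ hv => ?_) q
        have h1 := hv (c - 1) (hasse_int_adj.2 (by omega))
        have h2 := hv (c + 1) (hasse_int_adj.2 (by omega))
        rw [hQ c (by omega)] at h1 h2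
        rw [hQ (c + 1) (by omega)] at h2
        omega
  exact hall _ (pairwise_lineSites M) h hh

lemma isTransferFamily_line (M : ℕ) :
    IsTransferFamily M fun m => transfer (hopProd (hasse ℤ) (lineSites M)) (lineHeight 0)
      (lineHeight m) := by
  refine IsTransferFamily.of_hopProd (fun x y hx hy => commute_hopProd_lineSites M hx hy)
    (fun m hm q hq => ?_) (fun m hm => ⟨linePeaks m, by simp [linePeaks],
      hopProd_lineSites_heightIndicator hm⟩) (fun m hm => ?_) rfl
    (fun r h => ∀ c : ℤ, c ≤ 1 - r → h c = -c) (fun r hr c hc => ?_) (fun m _ h1 h => ?_)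
    (fun r q φ hφ h hh => ?_)
  · rw [hopProd_lineSites_heightIndicator hm, ← hopProd_reverse_lineSites_heightIndicator hm,
      hopProd_reverse_lineSites, hopProd_lineSites, ← Module.End.mul_apply]
    have := ascProd_mul_descProd_inv (fun i : ℕ => peakOp_int_mul_self ((i : ℤ) - M))
      (inv_ne_zero hq.ne') (2 * M + 1)
    rw [inv_inv] at this
    rw [this, Module.End.one_apply]
  · rw [hopProd_lineSites_heightIndicator hm, hopProd_zero_heightIndicator (nodup_linePeaks _)
      (pairwise_linePeaks _) (fun c hc => isPeak_lineHeight hc)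
      (fun c _ => ⟨c + 1, hasse_int_adj.2 (Or.inl rfl)⟩)]
    congr 1
    · simp [linePeaks]
    · congr 1
      funext c
      simp only [mem_linePeaks, lineHeight]
      split_ifs <;> omega
  · unfold lineHeight
    split_ifs <;> omega
  · have := h (1 - m) le_rfl
    unfold lineHeight at this
    split_ifs at this <;> omega
  · refine hopProd_lineSites_apply_eq_zero M r q φ (fun h hh => hφ h fun c hc => hh c ?_) h hh
    push_cast at hc
    omega

end LineFamily

section HalfLineFamily

open SimpleGraph

lemma hasse_nat_adj {a b : ℕ} : (hasse ℕ).Adj a b ↔ a + 1 = b ∨ b + 1 = a := by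
  simp [hasse_adj, Order.covBy_iff_add_one_eq]

/-- The sites `M, …, 1, 0, 1, …, M`. -/
def wallSites (M : ℕ) : List ℕ := (List.range (M + 1)).reverse ++ (List.range M).map (· + 1)

/-- The height function on the half-line descending from `2 * m` at the wall until it reaches the
diagonal. -/
def wallHeight (m c : ℕ) : ℤ := if c < m then 2 * m - c else c

lemma hopProd_wallSites (M : ℕ) (q : ℝ) :
    hopProd (hasse ℕ) (wallSites M) q = wallProd (peakOp (hasse ℕ)) M q := by
  have h1 : hopProd (hasse ℕ) (List.range (M + 1)).reverse q =
      descProd (peakOp (hasse ℕ)) (M + 1) q := rfl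
  have h2 : hopProd (hasse ℕ) ((List.range M).map (· + 1)) q =
      ascProd (fun i => peakOp (hasse ℕ) (i + 1)) M q := by
    rw [hopProd, List.map_map]
    rfl
  rw [wallSites, hopProd_append, h1, h2, descProd_succ', wallProd, mul_assoc]

lemma peakOp_nat_mul_self (c : ℕ) :
    peakOp (hasse ℕ) c * peakOp (hasse ℕ) c = peakOp (hasse ℕ) c :=
  peakOp_mul_self (hasse_nat_adj.2 (Or.inl (rfl : c + 1 = c + 1)))

lemma commute_hopProd_wallSites (M : ℕ) {x y : ℝ} (hx : x ≠ 0) (hy : y ≠ 0) :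
    Commute (hopProd (hasse ℕ) (wallSites M) x) (hopProd (hasse ℕ) (wallSites M) y) := by
  rw [hopProd_wallSites, hopProd_wallSites]
  refine wallProd_comm peakOp_nat_mul_self (fun i j hij => ?_) (fun i => ?_)
    (fun i => ?_) hx hy _
  · refine peakOp_comm (by omega) ?_
    rw [hasse_nat_adj]
    omega
  · refine peakOp_mul_mul_eq_zero (e := i) ?_ ?_ (by omega)
    · rw [hasse_nat_adj]
      omega
    · rw [hasse_nat_adj]
      omega
  · refine peakOp_mul_mul_eq_zero (e := i + 2) ?_ ?_ (by omega)
    · rw [hasse_nat_adj]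
      omega
    · rw [hasse_nat_adj]
      omega

lemma hopProd_wallSites_heightIndicator {m M : ℕ} (hm : m ≤ M) (q : ℝ) :
    hopProd (hasse ℕ) (wallSites M) q (heightIndicator (wallHeight m)) =
      hopProd (hasse ℕ) (List.range m).reverse q (heightIndicator (wallHeight m)) := by
  have hfilter : (List.range (M + 1)).filter (· < m) = List.range m := by
    obtain ⟨d, rfl⟩ := Nat.exists_eq_add_of_le hm
    rw [add_assoc, List.range_add, List.filter_append, List.filter_eq_self.2, List.filter_eq_nil_iff.2,
      List.append_nil]
    · simp
    · simp
  have hpos : hopProd (hasse ℕ) ((List.range M).map (· + 1)) q (heightIndicator (wallHeight m)) =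
      heightIndicator (wallHeight m) := by
    rw [hopProd_heightIndicator_eq_filter (fun _ => False) (fun c => if c < m then c - 1 else c + 1)]
    · simp [hopProd_nil]
    · intro c hc _
      have : c ≠ 0 := by
        rintro rfl
        simp at hc
      rw [hasse_nat_adj]
      unfold wallHeight
      split_ifs <;> omega
    · exact List.pairwise_of_forall fun c d _ hd => hd.elim
  rw [wallSites, hopProd_append, Module.End.mul_apply, hpos,
    hopProd_heightIndicator_eq_filter (· < m) (· + 1), List.filter_reverse, hfilter]
  · intro c _ hc
    rw [hasse_nat_adj]
    unfold wallHeight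
    split_ifs <;> omega
  · exact List.pairwise_of_forall fun c d hc hd => by omega

lemma hopProd_reverse_range_zero_heightIndicator {m j : ℕ} (hj : j ≤ m) :
    hopProd (hasse ℕ) (List.range j).reverse 0 (heightIndicator (wallHeight m)) =
      (-1 : ℝ) ^ j •
        heightIndicator fun c => if c < j then 2 * m - 2 - (c : ℤ) else wallHeight m c := by
  induction j with
  | zero => simp [hopProd_nil]
  | succ j ih =>
    have hp : IsPeak (hasse ℕ)
        (fun c => if c < j then 2 * m - 2 - (c : ℤ) else wallHeight m c) j := by
      intro d hd
      rw [hasse_nat_adj] at hd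
      unfold wallHeight
      dsimp only
      split_ifs <;> omega
    rw [List.range_succ, List.reverse_append, List.reverse_singleton, List.singleton_append,
      hopProd_cons, Module.End.mul_apply, ih (by omega), map_smul,
      hop_zero_heightIndicator (hasse_nat_adj.2 (Or.inl (rfl : j + 1 = j + 1))) hp,
      pow_succ, mul_neg_one, smul_neg, neg_smul]
    congr 3
    funext c
    rcases eq_or_ne c j with rfl | hc
    · simp only [update_self, wallHeight]
      split_ifs <;> omega
    · simp only [update_of_ne hc]
      split_ifs <;> omega

lemma hopProd_wallSites_apply_eq_zero (M r : ℕ) (q : ℝ) (φ : (ℕ → ℤ) → ℝ)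
    (hφ : ∀ h : ℕ → ℤ, h 0 ≤ 2 * r → φ h = 0) (h : ℕ → ℤ) (hh : h 0 ≤ 2 * r - 2) :
    hopProd (hasse ℕ) (wallSites M) q φ h = 0 := by
  have hpos : ∀ (cs : List ℕ) (x : ℤ) (ψ : (ℕ → ℤ) → ℝ), 0 ∉ cs →
      (∀ h : ℕ → ℤ, h 0 ≤ x → ψ h = 0) →
      ∀ h : ℕ → ℤ, h 0 ≤ x → hopProd (hasse ℕ) cs q ψ h = 0 := by
    intro cs x ψ h0 hψ
    induction cs with
    | nil => exact hψ
    | cons c cs ih =>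
      rw [List.mem_cons, not_or] at h0
      rw [hopProd_cons, Module.End.mul_apply]
      refine hop_apply_eq_zero (ih h0.2) (fun _ => id) c (fun h hQ _ _ => ?_) q
      rwa [update_of_ne h0.1]
  have hsites : wallSites M = ((List.range M).map (· + 1)).reverse ++
      0 :: (List.range M).map (· + 1) := by
    rw [wallSites, List.range_succ_eq_map]
    simp
  have h0 : 0 ∉ (List.range M).map (· + 1) := by simp
  rw [hsites, hopProd_append, hopProd_cons, Module.End.mul_apply, Module.End.mul_apply]
  refine hpos _ (2 * r - 2) _ (by simp) ?_ h hh
  refine hop_apply_eq_zero (hpos _ (2 * r) φ h0 hφ) (fun h hh => by omega) 0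
    (fun h hQ _ _ => ?_) q
  rw [update_self]
  omega

lemma isTransferFamily_wall (M : ℕ) :
    IsTransferFamily M fun m => transfer (hopProd (hasse ℕ) (wallSites M)) (wallHeight 0)
      (wallHeight m) := by
  refine IsTransferFamily.of_hopProd (fun x y hx hy => commute_hopProd_wallSites M hx hy)
    (fun m hm q hq => ?_) (fun m hm => ⟨(List.range m).reverse, by simp,
      hopProd_wallSites_heightIndicator hm⟩) (fun m hm => ?_) rfl
    (fun r h => h 0 ≤ 2 * r - 2) (fun r hr => ?_) (fun m _ h1 h => ?_)
    (fun r q φ hφ h hh => ?_)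
  · rw [hopProd_wallSites, hopProd_wallSites, ← Module.End.mul_apply,
      wallProd_inv_mul peakOp_nat_mul_self hq.ne', Module.End.one_apply]
  · rw [hopProd_wallSites_heightIndicator hm, hopProd_reverse_range_zero_heightIndicator le_rfl]
    congr 2
    funext c
    unfold wallHeight
    push_cast
    split_ifs <;> omega
  · unfold wallHeight
    split_ifs <;> omega
  · unfold wallHeight at h
    split_ifs at h <;> omega
  · refine hopProd_wallSites_apply_eq_zero M r q φ (fun h hh => hφ h ?_) h hh
    push_cast
    omega

end HalfLineFamily

section Counting

variable {ι : Type*} [DecidableEq ι] {G : SimpleGraph ι}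

variable (G) in
/-- `η` lies above the ground height `h₀`, has its parity, and changes by `1` along edges. -/
structure IsHeightAbove (h₀ η : ι → ℤ) : Prop where
  le (c : ι) : h₀ c ≤ η c
  parity (c : ι) : (η c - h₀ c) % 2 = 0
  step (c d : ι) : G.Adj c d → η d = η c + 1 ∨ η d = η c - 1

/-- The box at position `c` with top height `v` lies between `h₀` and `η`. -/
def IsBoxOf (h₀ η : ι → ℤ) (c : ι) (v : ℤ) : Prop := h₀ c < v ∧ v ≤ η c ∧ (v - h₀ c) % 2 = 0

variable (G) in
/-- Set-valued labellings of the boxes between `h₀` and `η` by times `t < N`, where the time `t`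
may only be used at the site `w t`, strictly increasing upwards along edges of `G`. A labelling is
recorded as the set of pairs of a time and the top height of a box carrying it. -/
def labellings (h₀ : ι → ℤ) (w : ℕ → ι) (N : ℕ) (η : ι → ℤ) : Set (Finset (ℕ × ℤ)) :=
  {R | (∀ t v, (t, v) ∈ R → t < N ∧ IsBoxOf h₀ η (w t) v) ∧
    (∀ c v, IsBoxOf h₀ η c v → ∃ t, (t, v) ∈ R ∧ w t = c) ∧
    ∀ t t' v, (t, v) ∈ R → (t', v + 1) ∈ R → G.Adj (w t) (w t') → t < t'}

omit [DecidableEq ι] in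
lemma IsHeightAbove.lt_of_isPeak {h₀ η : ι → ℤ} (hη : IsHeightAbove G h₀ η)
    (h₀step : ∀ c d, G.Adj c d → h₀ d = h₀ c + 1 ∨ h₀ d = h₀ c - 1)
    (h₀peak : ∀ c, ¬ IsPeak G h₀ c) {c : ι} (hc : IsPeak G η c) : h₀ c < η c := by
  refine lt_of_le_of_ne (hη.le c) fun h => h₀peak c fun d hd => ?_
  have h1 := hη.le d
  have h2 := hc d hd
  rcases h₀step c d hd with h3 | h3 <;> omega

lemma IsHeightAbove.lower {h₀ η : ι → ℤ} (hη : IsHeightAbove G h₀ η) {c : ι} (hc : IsPeak G η c)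
    (hlt : h₀ c < η c) : IsHeightAbove G h₀ (update η c (η c - 2)) where
  le d := by
    rcases eq_or_ne d c with rfl | hd
    · have := hη.parity d
      rw [update_self]
      omega
    · rw [update_of_ne hd]
      exact hη.le d
  parity d := by
    rcases eq_or_ne d c with rfl | hd
    · have := hη.parity d
      rw [update_self]
      omega
    · rw [update_of_ne hd]
      exact hη.parity d
  step a b hab := by
    rcases eq_or_ne a c with rfl | ha
    · have := hc b hab
      rw [update_self, update_of_ne hab.ne']
      omega
    rcases eq_or_ne b c with rfl | hb
    · have := hc a hab.symm
      rw [update_self, update_of_ne ha]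
      omega
    · rw [update_of_ne ha, update_of_ne hb]
      exact hη.step a b hab

omit [DecidableEq ι] in
/-- Only a peak can carry the last time, and then only its top box can. -/
lemma isPeak_of_mem_labellings {h₀ η : ι → ℤ} {w : ℕ → ι} {N : ℕ} {R : Finset (ℕ × ℤ)} {v : ℤ}
    (hη : IsHeightAbove G h₀ η)
    (h₀step : ∀ c d, G.Adj c d → h₀ d = h₀ c + 1 ∨ h₀ d = h₀ c - 1)
    (h₀peak : ∀ c, ¬ IsPeak G h₀ c)
    (hR : R ∈ labellings G h₀ w (N + 1) η) (hv : (N, v) ∈ R) :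
    v = η (w N) ∧ IsPeak G η (w N) := by
  obtain ⟨h1, h2, h3⟩ := hR
  obtain ⟨hv1, hv2, hv3⟩ := (h1 N v hv).2
  have hpar := hη.parity (w N)
  have key : ∀ d, G.Adj (w N) d → η d ≤ v := by
    intro d hd
    by_contra! hlt
    have hpar' := hη.parity d
    obtain ⟨t', ht', rfl⟩ := h2 d (v + 1) (by
      rcases h₀step _ _ hd with h | h <;> refine ⟨?_, ?_, ?_⟩ <;> omega)
    have := h3 N t' v hv ht' hd
    have := (h1 t' _ ht').1
    omega
  have hnb : ∃ d, G.Adj (w N) d := by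
    by_contra! hno
    exact h₀peak (w N) fun d hd => (hno d hd).elim
  obtain ⟨d, hd⟩ := hnb
  have hv : v = η (w N) := by
    have := key d hd
    rcases hη.step _ _ hd with h | h <;> omega
  refine ⟨hv, fun d hd => ?_⟩
  have := key d hd
  rcases hη.step _ _ hd with h | h <;> omega

omit [DecidableEq ι] in
lemma labellings_succ_of_not_isPeak {h₀ η : ι → ℤ} {w : ℕ → ι} {N : ℕ}
    (hη : IsHeightAbove G h₀ η)
    (h₀step : ∀ c d, G.Adj c d → h₀ d = h₀ c + 1 ∨ h₀ d = h₀ c - 1)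
    (h₀peak : ∀ c, ¬ IsPeak G h₀ c) (hc : ¬ IsPeak G η (w N)) :
    labellings G h₀ w (N + 1) η = labellings G h₀ w N η := by
  ext R
  refine ⟨fun hR => ⟨fun t v htv => ⟨?_, (hR.1 t v htv).2⟩, hR.2⟩,
    fun hR => ⟨fun t v htv => ⟨(hR.1 t v htv).1.trans (Nat.lt_succ_self N), (hR.1 t v htv).2⟩,
      hR.2⟩⟩
  have h1 := (hR.1 t v htv).1
  refine lt_of_le_of_ne (by omega) ?_
  rintro rfl
  exact hc (isPeak_of_mem_labellings hη h₀step h₀peak hR htv).2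

lemma isBoxOf_lower_iff {h₀ η : ι → ℤ} {c d : ι} {v : ℤ} (hpar : (η c - h₀ c) % 2 = 0) :
    IsBoxOf h₀ (update η c (η c - 2)) d v ↔ IsBoxOf h₀ η d v ∧ ¬ (d = c ∧ v = η c) := by
  unfold IsBoxOf
  rcases eq_or_ne d c with rfl | hd
  · rw [update_self]
    simp only [true_and]
    omega
  · rw [update_of_ne hd]
    simp [hd]

lemma labellings_succ_of_isPeak {h₀ η : ι → ℤ} {w : ℕ → ι} {N : ℕ}
    (hη : IsHeightAbove G h₀ η)
    (h₀step : ∀ c d, G.Adj c d → h₀ d = h₀ c + 1 ∨ h₀ d = h₀ c - 1)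
    (h₀peak : ∀ c, ¬ IsPeak G h₀ c) (hc : IsPeak G η (w N)) :
    labellings G h₀ w (N + 1) η = labellings G h₀ w N η ∪
      insert (N, η (w N)) '' (labellings G h₀ w N η ∪
        labellings G h₀ w N (update η (w N) (η (w N) - 2))) := by
  have hlt := hη.lt_of_isPeak h₀step h₀peak hc
  have hpar := hη.parity (w N)
  have hins : ∀ R : Finset (ℕ × ℤ), (∀ t v, (t, v) ∈ R → t < N ∧ IsBoxOf h₀ η (w t) v) →
      (∀ t t' v, (t, v) ∈ R → (t', v + 1) ∈ R → G.Adj (w t) (w t') → t < t') →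
      (∀ c v, IsBoxOf h₀ η c v → ¬ (c = w N ∧ v = η (w N)) → ∃ t, (t, v) ∈ R ∧ w t = c) →
      insert (N, η (w N)) R ∈ labellings G h₀ w (N + 1) η := by
    intro R h1 h3 h2
    refine ⟨fun t v htv => ?_, fun c v hcv => ?_, fun t t' v h h' hadj => ?_⟩
    · rcases Finset.mem_insert.1 htv with heq | htv
      · obtain ⟨rfl, rfl⟩ := Prod.mk.inj heq
        exact ⟨Nat.lt_succ_self _, hlt, le_rfl, hpar⟩
      · exact ⟨(h1 t v htv).1.trans (Nat.lt_succ_self N), (h1 t v htv).2⟩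
    · by_cases hcase : c = w N ∧ v = η (w N)
      · exact ⟨N, by rw [hcase.2]; exact Finset.mem_insert_self _ _, hcase.1.symm⟩
      · obtain ⟨t, ht, htc⟩ := h2 c v hcv hcase
        exact ⟨t, Finset.mem_insert_of_mem ht, htc⟩
    · rcases Finset.mem_insert.1 h with heq | h
      · obtain ⟨rfl, rfl⟩ := Prod.mk.inj heq
        rcases Finset.mem_insert.1 h' with heq' | h'
        · have := (Prod.mk.inj heq').2
          omega
        · have e1 := (h1 t' _ h').2.2.1
          have e2 := hc _ hadj
          omega
      · rcases Finset.mem_insert.1 h' with heq' | h'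
        · rw [(Prod.mk.inj heq').1]
          exact (h1 t v h).1
        · exact h3 t t' v h h' hadj
  ext R
  constructor
  · intro hR
    by_cases hN : ∃ v, (N, v) ∈ R
    · right
      obtain ⟨v, hv⟩ := hN
      obtain ⟨rfl, -⟩ := isPeak_of_mem_labellings hη h₀step h₀peak hR hv
      refine ⟨R.erase (N, η (w N)), ?_, Finset.insert_erase hv⟩
      have h1 : ∀ t v, (t, v) ∈ R.erase (N, η (w N)) → t < N ∧ IsBoxOf h₀ η (w t) v := by
        intro t v htv
        have hmem := Finset.mem_of_mem_erase htv
        have ht := hR.1 t v hmem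
        refine ⟨lt_of_le_of_ne (by omega) ?_, ht.2⟩
        rintro rfl
        rw [(isPeak_of_mem_labellings hη h₀step h₀peak hR hmem).1] at htv
        exact Finset.notMem_erase _ _ htv
      have h3 : ∀ t t' v, (t, v) ∈ R.erase (N, η (w N)) → (t', v + 1) ∈ R.erase (N, η (w N)) →
          G.Adj (w t) (w t') → t < t' := fun t t' v h h' =>
        hR.2.2 t t' v (Finset.mem_of_mem_erase h) (Finset.mem_of_mem_erase h')
      have h2 : ∀ c v, IsBoxOf h₀ η c v → ¬ (c = w N ∧ v = η (w N)) →
          ∃ t, (t, v) ∈ R.erase (N, η (w N)) ∧ w t = c := by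
        intro c v hcv hne
        obtain ⟨t, ht, rfl⟩ := hR.2.1 c v hcv
        refine ⟨t, Finset.mem_erase.2 ⟨fun heq => hne ?_, ht⟩, rfl⟩
        obtain ⟨rfl, rfl⟩ := Prod.mk.inj heq
        exact ⟨rfl, rfl⟩
      by_cases htop : ∃ t, (t, η (w N)) ∈ R.erase (N, η (w N)) ∧ w t = w N
      · refine Or.inl ⟨h1, fun c v hcv => ?_, h3⟩
        by_cases hcase : c = w N ∧ v = η (w N)
        · rw [hcase.1, hcase.2]
          exact htop
        · exact h2 c v hcv hcase
      · refine Or.inr ⟨fun t v htv => ⟨(h1 t v htv).1, ?_⟩, fun c v hcv => ?_, h3⟩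
        · refine (isBoxOf_lower_iff hpar).2 ⟨(h1 t v htv).2, ?_⟩
          rintro ⟨hwt, rfl⟩
          exact htop ⟨t, htv, hwt⟩
        · rw [isBoxOf_lower_iff hpar] at hcv
          exact h2 c v hcv.1 hcv.2
    · refine Or.inl ⟨fun t v htv => ⟨lt_of_le_of_ne ?_ ?_, (hR.1 t v htv).2⟩, hR.2⟩
      · have := (hR.1 t v htv).1
        omega
      · rintro rfl
        exact hN ⟨v, htv⟩
  · rintro (hR | ⟨R, hR | hR, rfl⟩)
    · exact ⟨fun t v htv => ⟨(hR.1 t v htv).1.trans (Nat.lt_succ_self N), (hR.1 t v htv).2⟩, hR.2⟩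
    · exact hins R hR.1 hR.2.2 fun c v hcv _ => hR.2.1 c v hcv
    · exact hins R (fun t v htv => ⟨(hR.1 t v htv).1,
        ((isBoxOf_lower_iff hpar).1 (hR.1 t v htv).2).1⟩) hR.2.2
        fun c v hcv hne => hR.2.1 c v ((isBoxOf_lower_iff hpar).2 ⟨hcv, hne⟩)

lemma ncard_labellings_succ_of_isPeak {h₀ η : ι → ℤ} {w : ℕ → ι} {N : ℕ}
    (hη : IsHeightAbove G h₀ η)
    (h₀step : ∀ c d, G.Adj c d → h₀ d = h₀ c + 1 ∨ h₀ d = h₀ c - 1)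
    (h₀peak : ∀ c, ¬ IsPeak G h₀ c) (hc : IsPeak G η (w N))
    (hf : (labellings G h₀ w N η).Finite)
    (hf' : (labellings G h₀ w N (update η (w N) (η (w N) - 2))).Finite) :
    (labellings G h₀ w (N + 1) η).ncard = (labellings G h₀ w N η).ncard +
      ((labellings G h₀ w N η).ncard +
        (labellings G h₀ w N (update η (w N) (η (w N) - 2))).ncard) := by
  have hlt := hη.lt_of_isPeak h₀step h₀peak hc
  have hnot : ∀ R ∈ labellings G h₀ w N η ∪
      labellings G h₀ w N (update η (w N) (η (w N) - 2)), (N, η (w N)) ∉ R := by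
    rintro R (hR | hR) h
    · exact (hR.1 _ _ h).1.ne rfl
    · exact (hR.1 _ _ h).1.ne rfl
  rw [labellings_succ_of_isPeak hη h₀step h₀peak hc, Set.ncard_union_eq _ hf
    ((hf.union hf').image _), Set.InjOn.ncard_image, Set.ncard_union_eq _ hf hf']
  · refine Set.disjoint_left.2 fun R hR hR' => ?_
    obtain ⟨t, ht, htc⟩ := hR.2.1 (w N) (η (w N)) ⟨hlt, le_rfl, hη.parity _⟩
    have := (hR'.1 t _ ht).2.2.1
    rw [htc, update_self] at this
    omega
  · intro R hR R' hR' heq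
    rw [← Finset.erase_insert (hnot R hR), ← Finset.erase_insert (hnot R' hR')]
    exact congrArg (Finset.erase · (N, η (w N))) heq
  · refine Set.disjoint_left.2 fun R hR => ?_
    rintro ⟨R, -, rfl⟩
    exact (hR.1 _ _ (Finset.mem_insert_self _ _)).1.ne rfl

/-- Labellings are counted by a product of hops with parameter `2`. -/
theorem ncard_labellings {h₀ η : ι → ℤ} {w : ℕ → ι}
    (h₀step : ∀ c d, G.Adj c d → h₀ d = h₀ c + 1 ∨ h₀ d = h₀ c - 1)
    (h₀peak : ∀ c, ¬ IsPeak G h₀ c) (N : ℕ) (hη : IsHeightAbove G h₀ η) :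
    (labellings G h₀ w N η).Finite ∧ ((labellings G h₀ w N η).ncard : ℝ) =
      hopProd G ((List.range N).map w) 2 (heightIndicator η) h₀ := by
  induction N generalizing η with
  | zero =>
    have hsub : labellings G h₀ w 0 η ⊆ {∅} := by
      intro R hR
      refine Finset.eq_empty_of_forall_notMem fun p hp => ?_
      exact absurd (hR.1 p.1 p.2 hp).1 (Nat.not_lt_zero _)
    refine ⟨(Set.finite_singleton _).subset hsub, ?_⟩
    simp only [List.range_zero, List.map_nil, hopProd_nil, Module.End.one_apply]
    by_cases h : η = h₀
    · subst h
      have : labellings G η w 0 η = {∅} := by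
        refine hsub.antisymm (Set.singleton_subset_iff.2 ⟨?_, fun c v hcv => ?_, ?_⟩)
        · simp
        · exact absurd (hcv.1.trans_le hcv.2.1) (lt_irrefl _)
        · simp
      rw [this, heightIndicator_self, Set.ncard_singleton, Nat.cast_one]
    · have : labellings G h₀ w 0 η = ∅ := by
        refine Set.eq_empty_of_forall_notMem fun R hR => h (funext fun c => ?_)
        by_contra hne
        obtain ⟨t, ht, -⟩ := hR.2.1 c (η c)
          ⟨lt_of_le_of_ne (hη.le c) (Ne.symm hne), le_rfl, hη.parity c⟩
        exact absurd (hR.1 _ _ ht).1 (Nat.not_lt_zero _)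
      rw [this, heightIndicator_of_ne (Ne.symm h), Set.ncard_empty, Nat.cast_zero]
  | succ N ih =>
    rw [List.range_succ, List.map_append, hopProd_append, List.map_singleton, hopProd_cons,
      hopProd_nil, mul_one, Module.End.mul_apply, hop_apply]
    obtain ⟨hf, hcard⟩ := ih hη
    by_cases hc : IsPeak G η (w N)
    · obtain ⟨d, hd⟩ : ∃ d, G.Adj (w N) d := by
        by_contra! hno
        exact h₀peak (w N) fun d hd => (hno d hd).elim
      obtain ⟨hf', hcard'⟩ := ih (hη.lower hc (hη.lt_of_isPeak h₀step h₀peak hc))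
      refine ⟨?_, ?_⟩
      · rw [labellings_succ_of_isPeak hη h₀step h₀peak hc]
        exact hf.union ((hf.union hf').image _)
      · rw [ncard_labellings_succ_of_isPeak hη h₀step h₀peak hc hf hf',
          peakOp_heightIndicator_of_isPeak hd hc]
        push_cast
        rw [hcard, hcard', map_add, map_smul, map_add]
        simp only [Pi.add_apply, Pi.smul_apply, smul_eq_mul]
        ring
    · have hex : ∃ d, G.Adj (w N) d ∧ η d ≠ η (w N) - 1 := by
        simpa [IsPeak] using hc
      obtain ⟨d, hd, hd'⟩ := hex
      rw [labellings_succ_of_not_isPeak hη h₀step h₀peak hc,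
        (agreeOff_heightIndicator η ∅).peakOp_eq_zero hd (Set.notMem_empty _)
          (Set.notMem_empty _) hd', smul_zero, add_zero]
      exact ⟨hf, hcard⟩

/-- Labellings by `n` rounds of the sites `w 0, …, w (W - 1)` are counted by `transfer`. -/
lemma ncard_labellings_eq_transfer {h₀ η : ι → ℤ} {w : ℕ → ι}
    (h₀step : ∀ c d, G.Adj c d → h₀ d = h₀ c + 1 ∨ h₀ d = h₀ c - 1)
    (h₀peak : ∀ c, ¬ IsPeak G h₀ c) (hη : IsHeightAbove G h₀ η) {W : ℕ}
    (hw : ∀ n i, i < W → w (n * W + i) = w i) (n : ℕ) :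
    ((labellings G h₀ w (n * W) η).ncard : ℝ) =
      transfer (hopProd G ((List.range W).map w)) h₀ η (List.replicate n 2) := by
  rw [(ncard_labellings h₀step h₀peak _ hη).2, transfer, List.reverse_replicate, List.map_replicate,
    List.prod_replicate]
  suffices h : hopProd G ((List.range (n * W)).map w) 2 =
      hopProd G ((List.range W).map w) 2 ^ n by rw [h]
  induction n with
  | zero => simp [hopProd_nil]
  | succ n ih =>
    have h1 : (List.range W).map (fun i => w (n * W + i)) = (List.range W).map w :=
      List.map_congr_left fun i hi => hw n i (List.mem_range.1 hi)
    rw [add_mul, one_mul, List.range_add, List.map_append, List.map_map, Function.comp_def, h1,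
      hopProd_append, ih, pow_succ]

end Counting

section Tableaux

/-- Tableaux with prescribed allowed entries `V` correspond to sets of coded entries. -/
lemma card_eq_ncard_of_injOn {P α β : Type*} [Fintype P] [Fintype α] {V : Set (P × α)}
    {e : P × α → β} (he : Set.InjOn e V) {IsT : (P → Finset α) → Prop} {S : Set (Finset β)}
    (hT : ∀ T, IsT T → ∀ p, ∀ a ∈ T p, (p, a) ∈ V) (hS : ∀ R ∈ S, ∀ b ∈ R, b ∈ e '' V)
    (hiff : ∀ T R, (∀ p, ∀ a ∈ T p, (p, a) ∈ V) → (∀ b ∈ R, b ∈ e '' V) →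
      (∀ x ∈ V, x.2 ∈ T x.1 ↔ e x ∈ R) → (IsT T ↔ R ∈ S)) :
    Nat.card {T // IsT T} = S.ncard := by
  classical
  let f : (P → Finset α) → Finset β := fun T =>
    (Finset.univ.filter fun x : P × α => x.2 ∈ T x.1).image e
  let g : Finset β → P → Finset α := fun R p =>
    Finset.univ.filter fun a => (p, a) ∈ V ∧ e (p, a) ∈ R
  have hf : ∀ T, (∀ p, ∀ a ∈ T p, (p, a) ∈ V) → ∀ x ∈ V, x.2 ∈ T x.1 ↔ e x ∈ f T := by
    intro T hT x hx
    simp only [f, Finset.mem_image, Finset.mem_filter, Finset.mem_univ, true_and]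
    refine ⟨fun h => ⟨x, h, rfl⟩, ?_⟩
    rintro ⟨y, hy, hyx⟩
    rwa [← he (hT _ _ hy) hx hyx]
  have hfV : ∀ T, (∀ p, ∀ a ∈ T p, (p, a) ∈ V) → ∀ b ∈ f T, b ∈ e '' V := by
    intro T hT b hb
    simp only [f, Finset.mem_image, Finset.mem_filter, Finset.mem_univ, true_and] at hb
    obtain ⟨x, hx, rfl⟩ := hb
    exact ⟨x, hT _ _ hx, rfl⟩
  have hgV : ∀ R, ∀ p, ∀ a ∈ g R p, (p, a) ∈ V := by
    intro R p a ha
    simp only [g, Finset.mem_filter, Finset.mem_univ, true_and] at ha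
    exact ha.1
  have hg : ∀ R, ∀ x ∈ V, x.2 ∈ g R x.1 ↔ e x ∈ R := by
    intro R x hx
    simp only [g, Finset.mem_filter, Finset.mem_univ, true_and]
    exact and_iff_right hx
  rw [← Nat.card_coe_set_eq]
  refine Nat.card_congr ⟨fun T => ⟨f T.1, ?_⟩, fun R => ⟨g R.1, ?_⟩, fun T => ?_, fun R => ?_⟩
  · exact (hiff T.1 _ (hT _ T.2) (hfV _ (hT _ T.2)) (hf _ (hT _ T.2))).1 T.2
  · exact (hiff _ R.1 (hgV _) (hS _ R.2) (hg _)).2 R.2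
  · refine Subtype.ext (funext fun p => Finset.ext fun a => ?_)
    by_cases hx : (p, a) ∈ V
    · rw [hg _ _ hx, ← hf _ (hT _ T.2) _ hx]
    · exact iff_of_false (fun h => hx (hgV _ _ _ h)) fun h => hx (hT _ T.2 _ _ h)
  · refine Subtype.ext (Finset.ext fun b => ?_)
    constructor
    · intro hb
      obtain ⟨x, hx, rfl⟩ := hfV _ (hgV _) b hb
      rwa [← hf _ (hgV _) x hx, hg _ x hx] at hb
    · intro hb
      obtain ⟨x, hx, rfl⟩ := hS _ R.2 b hb
      rwa [← hf _ (hgV _) x hx, hg _ x hx]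

lemma mul_add_lt_mul_add_iff {W a b x y : ℕ} (hx : x < W) (hy : y < W) :
    a * W + x < b * W + y ↔ a < b ∨ a = b ∧ x < y := by
  rcases lt_trichotomy a b with h | rfl | h
  · have := Nat.mul_le_mul_right W h
    rw [Nat.succ_mul] at this
    exact iff_of_true (by omega) (Or.inl h)
  · simp
  · have := Nat.mul_le_mul_right W h
    rw [Nat.succ_mul] at this
    exact iff_of_false (by omega) (by omega)

lemma mul_add_inj_iff {W a b x y : ℕ} (hx : x < W) (hy : y < W) :
    a * W + x = b * W + y ↔ a = b ∧ x = y := by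
  have h1 := mul_add_lt_mul_add_iff (a := a) (b := b) hx hy
  have h2 := mul_add_lt_mul_add_iff (a := b) (b := a) hy hx
  omega

section Ordinary

variable {m n : ℕ}

/-- The site of the line visited at time `t` when sweeping `-m, …, m` repeatedly. -/
def lineSite (m t : ℕ) : ℤ := ((t % (2 * m + 1) : ℕ) : ℤ) - m

/-- The time and height recording an entry of a box of an ordinary tableau. -/
def lineCode (x : (Fin (m + 1) × Fin (m + 1)) × Fin n) : ℕ × ℤ :=
  (x.2.val * (2 * m + 1) + (x.1.2.val + m - x.1.1.val), x.1.1.val + x.1.2.val + 2)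

lemma lineSite_mul_add (a : ℕ) {i : ℕ} (hi : i < 2 * m + 1) :
    lineSite m (a * (2 * m + 1) + i) = i - m := by
  rw [lineSite, Nat.mul_add_mod_of_lt hi]

lemma isBoxOf_line_iff {c v : ℤ} : IsBoxOf (lineHeight 0) (lineHeight m) c v ↔
    c + 2 ≤ v ∧ -c + 2 ≤ v ∧ v ≤ m + 1 ∧ (v - c) % 2 = 0 := by
  unfold IsBoxOf lineHeight
  split_ifs <;> omega

lemma lineSite_lineCode (x : (Fin (m + 1) × Fin (m + 1)) × Fin n) (hx : StairBox (m + 1) x.1) :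
    lineSite m (lineCode x).1 = (x.1.2.val : ℤ) - x.1.1.val := by
  obtain ⟨⟨i, j⟩, a⟩ := x
  dsimp only [StairBox] at hx
  dsimp only [lineCode]
  rw [lineSite_mul_add _ (by omega)]
  omega

lemma lineCode_injOn : Set.InjOn (lineCode (m := m) (n := n)) {x | StairBox (m + 1) x.1} := by
  rintro ⟨⟨i, j⟩, a⟩ hx ⟨⟨i', j'⟩, a'⟩ hx' h
  rw [Set.mem_ofPred_eq] at hx hx'
  dsimp only [StairBox] at hx hx'
  dsimp only [lineCode] at h
  obtain ⟨h1, h2⟩ := Prod.mk.inj h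
  rw [mul_add_inj_iff (by omega) (by omega)] at h1
  simp only [Prod.mk.injEq, Fin.ext_iff]
  omega

lemma isSVTStair_iff_mem_labellings {T : Fin (m + 1) × Fin (m + 1) → Finset (Fin n)}
    {R : Finset (ℕ × ℤ)} (hT : ∀ p, ∀ a ∈ T p, StairBox (m + 1) p)
    (hR : ∀ b ∈ R, b ∈ lineCode '' {x : (_ × _) × Fin n | StairBox (m + 1) x.1})
    (hTR : ∀ x : (_ × _) × Fin n, StairBox (m + 1) x.1 → (x.2 ∈ T x.1 ↔ lineCode x ∈ R)) :
    IsSVTStair (m + 1) n T ↔ R ∈ labellings (SimpleGraph.hasse ℤ) (lineHeight 0) (lineSite m)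
      (n * (2 * m + 1)) (lineHeight m) := by
  constructor
  · rintro ⟨hne, -, hrow, hcol⟩
    refine ⟨fun t v h => ?_, fun c v h => ?_, fun t t' v h h' hadj => ?_⟩
    · obtain ⟨x, hx, heq⟩ := hR _ h
      have hs := lineSite_lineCode x hx
      rw [heq] at hs
      obtain ⟨⟨i, j⟩, a⟩ := x
      rw [Set.mem_ofPred_eq] at hx
      dsimp only [StairBox] at hx hs
      dsimp only [lineCode] at heq
      obtain ⟨rfl, rfl⟩ := Prod.mk.inj heq
      rw [hs, isBoxOf_line_iff]
      refine ⟨?_, by omega⟩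
      have := (mul_add_lt_mul_add_iff (W := 2 * m + 1) (a := a.val) (b := n)
        (x := j.val + m - i.val) (y := 0) (by omega) (by omega)).2 (Or.inl a.2)
      simpa using this
    · rw [isBoxOf_line_iff] at h
      have hi : ((v - 2 - c) / 2).toNat < m + 1 := by omega
      have hj : ((v - 2 + c) / 2).toNat < m + 1 := by omega
      have hbox : StairBox (m + 1) (⟨_, hi⟩, ⟨_, hj⟩) := by
        dsimp only [StairBox]
        omega
      obtain ⟨a, ha⟩ := hne _ hbox
      have hmem := (hTR ((⟨_, hi⟩, ⟨_, hj⟩), a) hbox).1 ha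
      have hs := lineSite_lineCode ((⟨_, hi⟩, ⟨_, hj⟩), a) hbox
      refine ⟨_, ?_, hs.trans ?_⟩
      · convert hmem using 1
        refine Prod.ext rfl ?_
        dsimp only [lineCode]
        omega
      · dsimp only
        omega
    · obtain ⟨x, hx, heq⟩ := hR _ h
      obtain ⟨x', hx', heq'⟩ := hR _ h'
      have hs := lineSite_lineCode x hx
      have hs' := lineSite_lineCode x' hx'
      rw [← heq] at h
      rw [← heq'] at h'
      have hmem := (hTR x hx).2 h
      have hmem' := (hTR x' hx').2 h'
      rw [heq] at hs
      rw [heq'] at hs'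
      rw [hs, hs', hasse_int_adj] at hadj
      obtain ⟨⟨i, j⟩, a⟩ := x
      obtain ⟨⟨i', j'⟩, a'⟩ := x'
      rw [Set.mem_ofPred_eq] at hx hx'
      dsimp only [StairBox] at hx hx' hadj hmem hmem'
      dsimp only [lineCode] at heq heq'
      obtain ⟨rfl, rfl⟩ := Prod.mk.inj heq
      obtain ⟨rfl, hv⟩ := Prod.mk.inj heq'
      rw [mul_add_lt_mul_add_iff (by omega) (by omega)]
      rcases hadj with hadj | hadj
      · have := hrow (i, j) (i', j') (Fin.ext (by dsimp only; omega)) (by dsimp only; omega)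
          a hmem a' hmem'
        rw [Fin.le_def] at this
        omega
      · have := hcol (i, j) (i', j') (by dsimp only; omega) (Fin.ext (by dsimp only; omega))
          a hmem a' hmem'
        rw [Fin.lt_def] at this
        omega
  · rintro ⟨h1, h2, h3⟩
    have key : ∀ p q : Fin (m + 1) × Fin (m + 1), ∀ a ∈ T p, ∀ b ∈ T q,
        p.1.val + p.2.val + 1 = q.1.val + q.2.val →
        (q.1 = p.1 ∨ q.2 = p.2) → (lineCode (p, a)).1 < (lineCode (q, b)).1 := by
      intro p q a ha b hb hpq hor
      have hp := hT p a ha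
      have hq := hT q b hb
      refine h3 _ _ (p.1.val + p.2.val + 2) ((hTR (p, a) hp).1 ha) ?_ ?_
      · convert (hTR (q, b) hq).1 hb using 1
        refine Prod.ext rfl ?_
        dsimp only [lineCode]
        omega
      · rw [lineSite_lineCode _ hp, lineSite_lineCode _ hq, hasse_int_adj]
        dsimp only
        rw [Fin.ext_iff, Fin.ext_iff] at hor
        omega
    refine ⟨fun p hp => ?_, fun p hp => ?_, fun p q hpq hpq' a ha b hb => ?_,
      fun p q hpq hpq' a ha b hb => ?_⟩
    · have hp' : p.1.val + p.2.val + 2 ≤ m + 1 := hp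
      obtain ⟨t, ht, htc⟩ := h2 (p.2.val - p.1.val) (p.1.val + p.2.val + 2) (by
        rw [isBoxOf_line_iff]
        omega)
      obtain ⟨x, hx, heq⟩ := hR _ ht
      have hs := lineSite_lineCode x hx
      rw [heq, htc] at hs
      rw [← heq] at ht
      have hmem := (hTR x hx).2 ht
      have hv := congrArg Prod.snd heq
      dsimp only [lineCode] at hv
      have : x.1 = p := Prod.ext (Fin.ext (by omega)) (Fin.ext (by omega))
      exact ⟨x.2, this ▸ hmem⟩
    · exact Finset.eq_empty_of_forall_notMem fun a ha => hp (hT p a ha)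
    · have := key p q a ha b hb (by rw [hpq]; omega) (Or.inl hpq)
      have hp : p.1.val + p.2.val + 2 ≤ m + 1 := hT p a ha
      have hq : q.1.val + q.2.val + 2 ≤ m + 1 := hT q b hb
      dsimp only [lineCode] at this
      rw [mul_add_lt_mul_add_iff (by omega) (by omega)] at this
      rw [Fin.le_def]
      omega
    · have := key p q a ha b hb (by rw [hpq']; omega) (Or.inr hpq')
      have hp : p.1.val + p.2.val + 2 ≤ m + 1 := hT p a ha
      have hq : q.1.val + q.2.val + 2 ≤ m + 1 := hT q b hb
      dsimp only [lineCode] at this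
      rw [mul_add_lt_mul_add_iff (by omega) (by omega)] at this
      rw [Fin.ext_iff] at hpq'
      rw [Fin.lt_def]
      omega

lemma card_isSVTStair : Nat.card {T : Fin (m + 1) × Fin (m + 1) → Finset (Fin n) //
      IsSVTStair (m + 1) n T} =
    (labellings (SimpleGraph.hasse ℤ) (lineHeight 0) (lineSite m) (n * (2 * m + 1))
      (lineHeight m)).ncard := by
  refine card_eq_ncard_of_injOn lineCode_injOn (fun T hT p a ha => ?_) (fun R hR b hb => ?_)
    fun T R hT hR hTR => isSVTStair_iff_mem_labellings hT hR hTR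
  · by_contra hp
    rw [hT.2.1 p hp] at ha
    exact absurd ha (Finset.notMem_empty _)
  · obtain ⟨hlt, hbox⟩ := hR.1 b.1 b.2 hb
    rw [isBoxOf_line_iff] at hbox
    have hdm := Nat.div_add_mod' b.1 (2 * m + 1)
    have hs : lineSite m b.1 = ((b.1 % (2 * m + 1) : ℕ) : ℤ) - m := rfl
    have hmod := Nat.mod_lt b.1 (Nat.succ_pos (2 * m))
    rw [hs] at hbox
    have hi : ((b.2 - 2 - lineSite m b.1) / 2).toNat < m + 1 := by omega
    have hj : ((b.2 - 2 + lineSite m b.1) / 2).toNat < m + 1 := by omega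
    refine ⟨((⟨_, hi⟩, ⟨_, hj⟩), ⟨b.1 / (2 * m + 1), Nat.div_lt_of_lt_mul (by rwa [mul_comm])⟩), ?_,
      Prod.ext ?_ ?_⟩
    · rw [Set.mem_ofPred_eq]
      dsimp only [StairBox]
      omega
    · dsimp only [lineCode]
      omega
    · dsimp only [lineCode]
      omega

end Ordinary

end Tableaux

section Shifted

variable {m n : ℕ}

/-- The site of the half-line visited at time `t` when sweeping `m, …, 1, 0, 1, …, m` repeatedly. -/
def wallSite (m t : ℕ) : ℕ := (((t % (2 * m + 1) : ℕ) : ℤ) - m).natAbs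

/-- The time and height recording an entry of a box of a shifted tableau. -/
def wallCode (x : (Fin (m + 1) × Fin (m + 1)) × Fin (2 * n)) : ℕ × ℤ :=
  (x.2.val / 2 * (2 * m + 1) + (if x.2.val % 2 = 1 then m + x.1.2.val - x.1.1.val
    else m + x.1.1.val - x.1.2.val), x.1.1.val + x.1.2.val + 2)

/-- The boxes of the shifted staircase with a letter allowed in them. -/
def IsShiftedEntry (x : (Fin (m + 1) × Fin (m + 1)) × Fin (2 * n)) : Prop :=
  ShiftedStairBox (m + 1) x.1 ∧ (x.1.1 = x.1.2 → x.2.val % 2 = 1)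

lemma wallSite_mul_add (a : ℕ) {i : ℕ} (hi : i < 2 * m + 1) :
    wallSite m (a * (2 * m + 1) + i) = ((i : ℤ) - m).natAbs := by
  rw [wallSite, Nat.mul_add_mod_of_lt hi]

lemma isBoxOf_wall_iff {c : ℕ} {v : ℤ} : IsBoxOf (wallHeight 0) (wallHeight m) c v ↔
    (c : ℤ) + 2 ≤ v ∧ v ≤ 2 * m - c ∧ (v - c) % 2 = 0 := by
  unfold IsBoxOf wallHeight
  split_ifs <;> omega

lemma IsShiftedEntry.le {x : (Fin (m + 1) × Fin (m + 1)) × Fin (2 * n)} (hx : IsShiftedEntry x) :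
    x.1.1.val ≤ x.1.2.val ∧ x.1.2.val + 1 ≤ m ∧ (x.1.1.val = x.1.2.val → x.2.val % 2 = 1) := by
  obtain ⟨⟨h1, h2⟩, h3⟩ := hx
  exact ⟨h1, by omega, fun h => h3 (Fin.ext h)⟩

lemma wallSite_wallCode {x : (Fin (m + 1) × Fin (m + 1)) × Fin (2 * n)} (hx : IsShiftedEntry x) :
    wallSite m (wallCode x).1 = x.1.2.val - x.1.1.val := by
  have := hx.le
  dsimp only [wallCode]
  rw [wallSite_mul_add _ (by split_ifs <;> omega)]
  split_ifs <;> omega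

lemma wallCode_injOn : Set.InjOn (wallCode (m := m) (n := n)) {x | IsShiftedEntry x} := by
  rintro ⟨⟨i, j⟩, a⟩ hx ⟨⟨i', j'⟩, a'⟩ hx' h
  have hx := IsShiftedEntry.le hx
  have hx' := IsShiftedEntry.le hx'
  dsimp only at hx hx'
  dsimp only [wallCode] at h
  obtain ⟨h1, h2⟩ := Prod.mk.inj h
  rw [mul_add_inj_iff (by split_ifs <;> omega) (by split_ifs <;> omega)] at h1
  simp only [Prod.mk.injEq, Fin.ext_iff]
  split_ifs at h1 <;> omega

lemma wallCode_lt_iff_of_row {p q : Fin (m + 1) × Fin (m + 1)} {a b : Fin (2 * n)}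
    (hp : IsShiftedEntry (p, a)) (hq : IsShiftedEntry (q, b)) (h1 : q.1 = p.1)
    (h2 : (q.2 : ℕ) = (p.2 : ℕ) + 1) :
    (wallCode (p, a)).1 < (wallCode (q, b)).1 ↔ a < b ∨ a = b ∧ a.val % 2 = 1 := by
  have hx := hp.le
  have hx' := hq.le
  dsimp only at hx hx'
  rw [Fin.ext_iff] at h1
  dsimp only [wallCode]
  rw [mul_add_lt_mul_add_iff (by split_ifs <;> omega) (by split_ifs <;> omega), Fin.lt_def,
    Fin.ext_iff]
  split_ifs <;> omega

lemma wallCode_lt_iff_of_column {p q : Fin (m + 1) × Fin (m + 1)} {a b : Fin (2 * n)}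
    (hp : IsShiftedEntry (p, a)) (hq : IsShiftedEntry (q, b)) (h1 : (q.1 : ℕ) = (p.1 : ℕ) + 1)
    (h2 : q.2 = p.2) :
    (wallCode (p, a)).1 < (wallCode (q, b)).1 ↔ a < b ∨ a = b ∧ a.val % 2 = 0 := by
  have hx := hp.le
  have hx' := hq.le
  dsimp only at hx hx'
  rw [Fin.ext_iff] at h2
  dsimp only [wallCode]
  rw [mul_add_lt_mul_add_iff (by split_ifs <;> omega) (by split_ifs <;> omega), Fin.lt_def,
    Fin.ext_iff]
  split_ifs <;> omega

/-- The local conditions defining shifted set-valued tableaux. -/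
lemma isSSVTPStair_iff {T : Fin (m + 1) × Fin (m + 1) → Finset (Fin (2 * n))}
    (hT : ∀ p, ∀ a ∈ T p, IsShiftedEntry (p, a)) :
    IsSSVTPStair (m + 1) n T ↔ (∀ p, ShiftedStairBox (m + 1) p → (T p).Nonempty) ∧
      (∀ p q : Fin (m + 1) × Fin (m + 1), q.1 = p.1 → (q.2 : ℕ) = (p.2 : ℕ) + 1 →
        ∀ a ∈ T p, ∀ b ∈ T q, a < b ∨ a = b ∧ a.val % 2 = 1) ∧
      (∀ p q : Fin (m + 1) × Fin (m + 1), (q.1 : ℕ) = (p.1 : ℕ) + 1 → q.2 = p.2 →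
        ∀ a ∈ T p, ∀ b ∈ T q, a < b ∨ a = b ∧ a.val % 2 = 0) := by
  constructor
  · rintro ⟨hne, -, hrow, hcol, hunprimed, hprimed, -⟩
    refine ⟨hne, fun p q h1 h2 a ha b hb => ?_, fun p q h1 h2 a ha b hb => ?_⟩
    · rcases (hrow p q h1 h2 a ha b hb).lt_or_eq with h | rfl
      · exact Or.inl h
      · refine Or.inr ⟨rfl, (Nat.mod_two_eq_zero_or_one _).resolve_left fun h => ?_⟩
        exact hprimed p q h1.symm (fun h => by rw [h] at h2; omega) a ha h hb
    · rcases (hcol p q h1 h2 a ha b hb).lt_or_eq with h | rfl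
      · exact Or.inl h
      · refine Or.inr ⟨rfl, (Nat.mod_two_eq_zero_or_one _).resolve_right fun h => ?_⟩
        exact hunprimed p q h2.symm (fun h => by rw [h] at h1; omega) a ha h hb
  · rintro ⟨hne, hrow, hcol⟩
    have hcol' : ∀ d : ℕ, ∀ p q : Fin (m + 1) × Fin (m + 1), (q.1 : ℕ) = (p.1 : ℕ) + d + 1 →
        q.2 = p.2 → ∀ a ∈ T p, a.val % 2 = 1 → ∀ b ∈ T q, a < b := by
      intro d
      induction d with
      | zero =>
        intro p q h1 h2 a ha hodd b hb
        exact (hcol p q h1 h2 a ha b hb).resolve_right fun h => by omega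
      | succ d ih =>
        intro p q h1 h2 a ha hodd b hb
        have hq := (hT q b hb).le
        dsimp only at hq
        have hlt : (q.1 : ℕ) - 1 < m + 1 := by omega
        obtain ⟨c, hc⟩ := hne (⟨(q.1 : ℕ) - 1, hlt⟩, q.2) (by
          dsimp only [ShiftedStairBox]; omega)
        have hac := ih p (⟨(q.1 : ℕ) - 1, hlt⟩, q.2) (by dsimp only; omega) h2 a ha hodd c hc
        rcases hcol (⟨(q.1 : ℕ) - 1, hlt⟩, q.2) q (by dsimp only; omega) rfl c hc b hb with h | h
        · exact hac.trans h
        · exact h.1 ▸ hac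
    have hrow' : ∀ d : ℕ, ∀ p q : Fin (m + 1) × Fin (m + 1), q.1 = p.1 →
        (q.2 : ℕ) = (p.2 : ℕ) + d + 1 → ∀ a ∈ T p, a.val % 2 = 0 → ∀ b ∈ T q, a < b := by
      intro d
      induction d with
      | zero =>
        intro p q h1 h2 a ha heven b hb
        exact (hrow p q h1 h2 a ha b hb).resolve_right fun h => by omega
      | succ d ih =>
        intro p q h1 h2 a ha heven b hb
        have hp := (hT p a ha).le
        have hq := (hT q b hb).le
        dsimp only at hp hq
        have hlt : (q.2 : ℕ) - 1 < m + 1 := by omega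
        obtain ⟨c, hc⟩ := hne (q.1, ⟨(q.2 : ℕ) - 1, hlt⟩) (by
          dsimp only [ShiftedStairBox]; rw [h1]; omega)
        have hac := ih p (q.1, ⟨(q.2 : ℕ) - 1, hlt⟩) h1 (by dsimp only; omega) a ha heven c hc
        rcases hrow (q.1, ⟨(q.2 : ℕ) - 1, hlt⟩) q rfl (by dsimp only; omega) c hc b hb with h | h
        · exact hac.trans h
        · exact h.1 ▸ hac
    refine ⟨hne, fun p hp => ?_, fun p q h1 h2 a ha b hb => ?_, fun p q h1 h2 a ha b hb => ?_,
      fun p q h1 h2 a ha hodd hb => ?_, fun p q h1 h2 a ha heven hb => ?_, fun p h a ha => ?_⟩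
    · exact Finset.eq_empty_of_forall_notMem fun a ha => hp (hT p a ha).1
    · rcases hrow p q h1 h2 a ha b hb with h | h
      exacts [h.le, h.1.le]
    · rcases hcol p q h1 h2 a ha b hb with h | h
      exacts [h.le, h.1.le]
    · rcases lt_or_gt_of_ne (Fin.val_ne_of_ne h2) with h | h
      · exact (hcol' (q.1 - p.1 - 1) p q (by omega) h1.symm a ha hodd a hb).ne rfl
      · exact (hcol' (p.1 - q.1 - 1) q p (by omega) h1 a hb hodd a ha).ne rfl
    · rcases lt_or_gt_of_ne (Fin.val_ne_of_ne h2) with h | h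
      · exact (hrow' (q.2 - p.2 - 1) p q h1.symm (by omega) a ha heven a hb).ne rfl
      · exact (hrow' (p.2 - q.2 - 1) q p h1 (by omega) a hb heven a ha).ne rfl
    · exact (hT p a ha).2 h

lemma isSSVTPStair_iff_mem_labellings {T : Fin (m + 1) × Fin (m + 1) → Finset (Fin (2 * n))}
    {R : Finset (ℕ × ℤ)} (hT : ∀ p, ∀ a ∈ T p, IsShiftedEntry (p, a))
    (hR : ∀ b ∈ R, b ∈ wallCode '' {x : (Fin (m + 1) × Fin (m + 1)) × Fin (2 * n) |
      IsShiftedEntry x})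
    (hTR : ∀ x : (_ × _) × Fin (2 * n), IsShiftedEntry x → (x.2 ∈ T x.1 ↔ wallCode x ∈ R)) :
    IsSSVTPStair (m + 1) n T ↔ R ∈ labellings (SimpleGraph.hasse ℕ) (wallHeight 0) (wallSite m)
      (n * (2 * m + 1)) (wallHeight m) := by
  rw [isSSVTPStair_iff hT]
  constructor
  · rintro ⟨hne, hrow, hcol⟩
    refine ⟨fun t v h => ?_, fun c v h => ?_, fun t t' v h h' hadj => ?_⟩
    · obtain ⟨x, hx, heq⟩ := hR _ h
      have hs := wallSite_wallCode hx
      have hle := IsShiftedEntry.le hx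
      rw [heq] at hs
      obtain ⟨⟨i, j⟩, a⟩ := x
      dsimp only at hs hle
      dsimp only [wallCode] at heq
      obtain ⟨rfl, rfl⟩ := Prod.mk.inj heq
      rw [hs, isBoxOf_wall_iff]
      refine ⟨?_, by omega⟩
      have := (mul_add_lt_mul_add_iff (W := 2 * m + 1) (a := a.val / 2) (b := n)
        (x := if a.val % 2 = 1 then m + j.val - i.val else m + i.val - j.val) (y := 0)
        (by split_ifs <;> omega) (by omega)).2 (Or.inl (by omega))
      simpa using this
    · rw [isBoxOf_wall_iff] at h
      have hi : ((v - 2 - c) / 2).toNat < m + 1 := by omega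
      have hj : ((v - 2 + c) / 2).toNat < m + 1 := by omega
      have hbox : ShiftedStairBox (m + 1) (⟨_, hi⟩, ⟨_, hj⟩) := by
        dsimp only [ShiftedStairBox]
        omega
      obtain ⟨a, ha⟩ := hne _ hbox
      have hmem := (hTR ((⟨_, hi⟩, ⟨_, hj⟩), a) (hT _ _ ha)).1 ha
      have hs := wallSite_wallCode (hT _ _ ha)
      refine ⟨_, ?_, hs.trans ?_⟩
      · convert hmem using 1
        refine Prod.ext rfl ?_
        dsimp only [wallCode]
        omega
      · dsimp only
        omega
    · obtain ⟨x, hx, heq⟩ := hR _ h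
      obtain ⟨x', hx', heq'⟩ := hR _ h'
      have hs := wallSite_wallCode hx
      have hs' := wallSite_wallCode hx'
      rw [← heq] at h
      rw [← heq'] at h'
      have hmem := (hTR x hx).2 h
      have hmem' := (hTR x' hx').2 h'
      have hle := IsShiftedEntry.le hx
      have hle' := IsShiftedEntry.le hx'
      have hv := congrArg Prod.snd heq
      have hv' := congrArg Prod.snd heq'
      obtain rfl := congrArg Prod.fst heq
      obtain rfl := congrArg Prod.fst heq'
      rw [hs, hs', hasse_nat_adj] at hadj
      dsimp only [wallCode] at hv hv'
      rcases hadj with hadj | hadj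
      · have h1 : x'.1.1 = x.1.1 := Fin.ext (by omega)
        have h2 : (x'.1.2 : ℕ) = (x.1.2 : ℕ) + 1 := by omega
        exact (wallCode_lt_iff_of_row hx hx' h1 h2).2 (hrow _ _ h1 h2 _ hmem _ hmem')
      · have h1 : (x'.1.1 : ℕ) = (x.1.1 : ℕ) + 1 := by omega
        have h2 : x'.1.2 = x.1.2 := Fin.ext (by omega)
        exact (wallCode_lt_iff_of_column hx hx' h1 h2).2 (hcol _ _ h1 h2 _ hmem _ hmem')
  · rintro ⟨h1, h2, h3⟩
    have key : ∀ p q : Fin (m + 1) × Fin (m + 1), ∀ a ∈ T p, ∀ b ∈ T q,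
        p.1.val + p.2.val + 1 = q.1.val + q.2.val →
        (q.1 = p.1 ∨ q.2 = p.2) → (wallCode (p, a)).1 < (wallCode (q, b)).1 := by
      intro p q a ha b hb hpq hor
      have hp := hT p a ha
      have hq := hT q b hb
      have hp' := hp.le
      have hq' := hq.le
      refine h3 _ _ (p.1.val + p.2.val + 2) ((hTR (p, a) hp).1 ha) ?_ ?_
      · convert (hTR (q, b) hq).1 hb using 1
        refine Prod.ext rfl ?_
        dsimp only [wallCode]
        omega
      · rw [wallSite_wallCode hp, wallSite_wallCode hq, hasse_nat_adj]
        dsimp only at hp' hq' ⊢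
        rw [Fin.ext_iff, Fin.ext_iff] at hor
        omega
    refine ⟨fun p hp => ?_, fun p q hpq hpq' a ha b hb => ?_, fun p q hpq hpq' a ha b hb => ?_⟩
    · obtain ⟨hp1, hp2⟩ := hp
      obtain ⟨t, ht, htc⟩ := h2 (p.2.val - p.1.val) (p.1.val + p.2.val + 2) (by
        rw [isBoxOf_wall_iff]
        omega)
      obtain ⟨x, hx, heq⟩ := hR _ ht
      have hs := wallSite_wallCode hx
      have hle := IsShiftedEntry.le hx
      rw [heq, htc] at hs
      rw [← heq] at ht
      have hmem := (hTR x hx).2 ht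
      have hv := congrArg Prod.snd heq
      dsimp only [wallCode] at hv
      have : x.1 = p := Prod.ext (Fin.ext (by omega)) (Fin.ext (by omega))
      exact ⟨x.2, this ▸ hmem⟩
    · exact (wallCode_lt_iff_of_row (hT p a ha) (hT q b hb) hpq hpq').1
        (key p q a ha b hb (by rw [hpq]; omega) (Or.inl hpq))
    · exact (wallCode_lt_iff_of_column (hT p a ha) (hT q b hb) hpq hpq').1
        (key p q a ha b hb (by rw [hpq']; omega) (Or.inr hpq'))

lemma card_isSSVTPStair : Nat.card {T : Fin (m + 1) × Fin (m + 1) → Finset (Fin (2 * n)) //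
      IsSSVTPStair (m + 1) n T} =
    (labellings (SimpleGraph.hasse ℕ) (wallHeight 0) (wallSite m) (n * (2 * m + 1))
      (wallHeight m)).ncard := by
  refine card_eq_ncard_of_injOn wallCode_injOn (fun T hT p a ha => ⟨?_, fun h => ?_⟩)
    (fun R hR b hb => ?_) fun T R hT hR hTR => isSSVTPStair_iff_mem_labellings hT hR hTR
  · by_contra hp
    rw [hT.2.1 p hp] at ha
    exact absurd ha (Finset.notMem_empty _)
  · exact hT.2.2.2.2.2.2 p h a ha
  · obtain ⟨hlt, hbox⟩ := hR.1 b.1 b.2 hb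
    rw [isBoxOf_wall_iff] at hbox
    have hdm := Nat.div_add_mod' b.1 (2 * m + 1)
    have hs : wallSite m b.1 = (((b.1 % (2 * m + 1) : ℕ) : ℤ) - m).natAbs := rfl
    have hmod := Nat.mod_lt b.1 (Nat.succ_pos (2 * m))
    have hdiv : b.1 / (2 * m + 1) < n := Nat.div_lt_of_lt_mul (by rwa [mul_comm])
    have hi : ((b.2 - 2 - wallSite m b.1) / 2).toNat < m + 1 := by omega
    have hj : ((b.2 - 2 + wallSite m b.1) / 2).toNat < m + 1 := by omega
    obtain ⟨a, ha, hodd⟩ : ∃ a : Fin (2 * n), a.val / 2 = b.1 / (2 * m + 1) ∧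
        (a.val % 2 = 1 ↔ m ≤ b.1 % (2 * m + 1)) := by
      by_cases h : m ≤ b.1 % (2 * m + 1)
      · exact ⟨⟨2 * (b.1 / (2 * m + 1)) + 1, by omega⟩, by dsimp only; omega, by dsimp only; omega⟩
      · exact ⟨⟨2 * (b.1 / (2 * m + 1)), by omega⟩, by dsimp only; omega, by dsimp only; omega⟩
    refine ⟨((⟨_, hi⟩, ⟨_, hj⟩), a), ⟨?_, fun h => ?_⟩, Prod.ext ?_ ?_⟩
    · dsimp only [ShiftedStairBox]
      omega
    · have h := congrArg Fin.val h
      dsimp only at h ⊢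
      omega
    · dsimp only [wallCode]
      rw [ha]
      split_ifs with h <;> rw [hodd] at h <;> omega
    · dsimp only [wallCode]
      omega

end Shifted

section Comparison

lemma map_lineSite_range (m : ℕ) :
    (List.range (2 * m + 1)).map (lineSite m) = lineSites m := by
  refine List.map_congr_left fun i hi => ?_
  rw [lineSite, Nat.mod_eq_of_lt (List.mem_range.1 hi)]

lemma map_wallSite_range (m : ℕ) :
    (List.range (2 * m + 1)).map (wallSite m) = wallSites m := by
  refine List.ext_getElem (by simp [wallSites]; omega) fun i hi _ => ?_
  rw [List.length_map, List.length_range] at hi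
  simp only [wallSites, wallSite, List.getElem_map, List.getElem_range, List.getElem_append,
    List.length_reverse, List.length_range, List.getElem_reverse, Nat.mod_eq_of_lt hi]
  split_ifs <;> omega

lemma lineHeight_step (m : ℕ) (c d : ℤ) (hcd : (SimpleGraph.hasse ℤ).Adj c d) :
    lineHeight m d = lineHeight m c + 1 ∨ lineHeight m d = lineHeight m c - 1 := by
  rw [hasse_int_adj] at hcd
  unfold lineHeight
  split_ifs <;> omega

lemma wallHeight_step (m c d : ℕ) (hcd : (SimpleGraph.hasse ℕ).Adj c d) :
    wallHeight m d = wallHeight m c + 1 ∨ wallHeight m d = wallHeight m c - 1 := by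
  rw [hasse_nat_adj] at hcd
  unfold wallHeight
  split_ifs <;> omega

lemma not_isPeak_lineHeight_zero (c : ℤ) :
    ¬ IsPeak (SimpleGraph.hasse ℤ) (lineHeight 0) c := by
  intro h
  have h1 := h (c + 1) (hasse_int_adj.2 (Or.inl rfl))
  have h2 := h (c - 1) (hasse_int_adj.2 (Or.inr (by omega)))
  unfold lineHeight at h1 h2
  split_ifs at h1 h2 <;> omega

lemma not_isPeak_wallHeight_zero (c : ℕ) :
    ¬ IsPeak (SimpleGraph.hasse ℕ) (wallHeight 0) c := by
  intro h
  have h1 := h (c + 1) (hasse_nat_adj.2 (Or.inl rfl))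
  unfold wallHeight at h1
  split_ifs at h1 <;> omega

lemma isHeightAbove_lineHeight (m : ℕ) :
    IsHeightAbove (SimpleGraph.hasse ℤ) (lineHeight 0) (lineHeight m) where
  le c := by unfold lineHeight; split_ifs <;> omega
  parity c := by unfold lineHeight; split_ifs <;> omega
  step := lineHeight_step m

lemma isHeightAbove_wallHeight (m : ℕ) :
    IsHeightAbove (SimpleGraph.hasse ℕ) (wallHeight 0) (wallHeight m) where
  le c := by unfold wallHeight; split_ifs <;> omega
  parity c := by unfold wallHeight; split_ifs <;> omega
  step := wallHeight_step m

lemma card_isSVTStair_eq_transfer (m n : ℕ) :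
    (Nat.card {T : Fin (m + 1) × Fin (m + 1) → Finset (Fin n) // IsSVTStair (m + 1) n T} : ℝ) =
      transfer (hopProd (SimpleGraph.hasse ℤ) (lineSites m)) (lineHeight 0) (lineHeight m)
        (List.replicate n 2) := by
  rw [card_isSVTStair, ← map_lineSite_range]
  refine ncard_labellings_eq_transfer (lineHeight_step 0) not_isPeak_lineHeight_zero
    (isHeightAbove_lineHeight m) (fun a i hi => ?_) n
  rw [lineSite_mul_add a hi, lineSite, Nat.mod_eq_of_lt hi]

lemma card_isSSVTPStair_eq_transfer (m n : ℕ) :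
    (Nat.card {T : Fin (m + 1) × Fin (m + 1) → Finset (Fin (2 * n)) //
      IsSSVTPStair (m + 1) n T} : ℝ) =
      transfer (hopProd (SimpleGraph.hasse ℕ) (wallSites m)) (wallHeight 0) (wallHeight m)
        (List.replicate n 2) := by
  rw [card_isSSVTPStair, ← map_wallSite_range]
  refine ncard_labellings_eq_transfer (wallHeight_step 0) not_isPeak_wallHeight_zero
    (isHeightAbove_wallHeight m) (fun a i hi => ?_) n
  rw [wallSite_mul_add a hi, wallSite, Nat.mod_eq_of_lt hi]

end Comparison

/-- For `k ≥ 1` and `n ≥ k - 1`, the number of shifted set-valued semistandard tableaux of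
shifted staircase shape equals the number of set-valued semistandard tableaux of staircase
shape: `|SSVT_P(δ̃_k, n)| = |SVT(δ_k, n)|`. -/
theorem ssvtP_card_eq_svt_card (k n : ℕ) (hk : 1 ≤ k) (hn : k - 1 ≤ n) :
    Nat.card {T : Fin k × Fin k → Finset (Fin (2 * n)) // IsSSVTPStair k n T}
      = Nat.card {T : Fin k × Fin k → Finset (Fin n) // IsSVTStair k n T} := by
  obtain ⟨m, rfl⟩ := Nat.exists_eq_add_of_le' hk
  rw [← Nat.cast_inj (R := ℝ), card_isSSVTPStair_eq_transfer, card_isSVTStair_eq_transfer]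
  exact (isTransferFamily_wall m).eq_replicate (isTransferFamily_line m) le_rfl
    (continuous_transfer_hopProd _ _ _ _) (continuous_transfer_hopProd _ _ _ _) n
end
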